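/- arXiv:2106.08583 — 2 statements merged into one kernel-verified Lean document; each statement's English description precedes it below -/
import Mathlib

section
/- Let R be a d-dimensional Cohen–Macaulay local ring with canonical module ω and Matlis duality (-)^∨. Let M, N be finitely generated R-modules with M locally free on the punctured spectrum of R and N maximal Cohen–Macaulay. Then Ext^{d+i}_R(M, Hom_R(N, ω))^∨ ≅ Tor_i^R(M, N) for every integer i > 0. -/
open CategoryTheory TensorProduct IsLocalRing

noncomputable section

/-- The `n`-th Ext group of two `R`-modules. -/
abbrev extGroup (R : Type) [CommRing R] (n : ℕ) (M N : Type) [AddCommGroup M] [Module R M]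
    [AddCommGroup N] [Module R N] : Type :=
  ((Ext R (ModuleCat R) n).obj (Opposite.op (ModuleCat.of R M))).obj (ModuleCat.of R N)

/-- The `n`-th Tor group of two `R`-modules. -/
abbrev torGroup (R : Type) [CommRing R] (n : ℕ) (M N : Type) [AddCommGroup M] [Module R M]
    [AddCommGroup N] [Module R N] : Type :=
  ((Tor (ModuleCat R) n).obj (ModuleCat.of R M)).obj (ModuleCat.of R N)

/-- The depth of a module over a local ring, as the infimum of the degrees in which
`Ext(k, N)` is nonzero. -/
def moduleDepth (R : Type) [CommRing R] [IsLocalRing R] (N : Type) [AddCommGroup N]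
    [Module R N] : ℕ∞ :=
  sInf {n : ℕ∞ | ∃ k : ℕ, n = k ∧
    Nontrivial (extGroup R k (R ⧸ IsLocalRing.maximalIdeal R) N)}

/-- A module is maximal Cohen–Macaulay if `depth M_p = dim R_p` for all `p` in the support. -/
def IsMCM (R : Type) [CommRing R] (M : Type) [AddCommGroup M] [Module R M] : Prop :=
  ∀ p : PrimeSpectrum R, Nontrivial (LocalizedModule p.asIdeal.primeCompl M) →
    (moduleDepth (Localization.AtPrime p.asIdeal)
        (LocalizedModule p.asIdeal.primeCompl M) : WithBot ℕ∞) =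
      ringKrullDim (Localization.AtPrime p.asIdeal)

/-- A local ring is Cohen–Macaulay if its depth equals its Krull dimension. -/
def IsCMLocal (R : Type) [CommRing R] [IsLocalRing R] : Prop :=
  (moduleDepth R R : WithBot ℕ∞) = ringKrullDim R

/-- Injective dimension at most `n`, defined recursively via cosyzygies. -/
def hasInjDimLE (R : Type) [CommRing R] : ℕ → ∀ (M : Type) [AddCommGroup M] [Module R M], Prop
  | 0, M, _, _ => Module.Injective R M
  | (n+1), M, _, _ => ∃ (I : Type) (_ : AddCommGroup I) (_ : Module R I) (f : M →ₗ[R] I),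
      Module.Injective R I ∧ Function.Injective f ∧
        hasInjDimLE R n (I ⧸ LinearMap.range f)

/-- Projective dimension at most `n`, defined recursively via syzygies. -/
def hasPdLE (R : Type) [CommRing R] : ℕ → ∀ (M : Type) [AddCommGroup M] [Module R M], Prop
  | 0, M, _, _ => Module.Projective R M
  | (n+1), M, _, _ => ∃ (P : Type) (_ : AddCommGroup P) (_ : Module R P) (f : P →ₗ[R] M),
      Module.Projective R P ∧ Function.Surjective f ∧ hasPdLE R n (LinearMap.ker f)

/-- `ω` is a canonical module of the Cohen–Macaulay local ring `R`: it is finitely generated,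
maximal Cohen–Macaulay, of finite injective dimension, and of type one. -/
def IsCanonicalModule (R : Type) [CommRing R] [IsLocalRing R] (ω : Type) [AddCommGroup ω]
    [Module R ω] : Prop :=
  Module.Finite R ω ∧ IsMCM R ω ∧ (∃ n, hasInjDimLE R n ω) ∧
    ∃ d : ℕ, ringKrullDim R = d ∧
      Nonempty (extGroup R d (R ⧸ IsLocalRing.maximalIdeal R) ω ≃ₗ[R]
        (R ⧸ IsLocalRing.maximalIdeal R))

/-- `T` is an Auslander transpose of `M`: the cokernel of the `R`-dual of a minimal
free presentation of `M`. -/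
def IsAuslanderTranspose (R : Type) [CommRing R] [IsLocalRing R] (M T : Type)
    [AddCommGroup M] [Module R M] [AddCommGroup T] [Module R T] : Prop :=
  ∃ (m n : ℕ) (f : (Fin n → R) →ₗ[R] (Fin m → R)),
    LinearMap.range f ≤ (IsLocalRing.maximalIdeal R) • (⊤ : Submodule R (Fin m → R)) ∧
    LinearMap.ker f ≤ (IsLocalRing.maximalIdeal R) • (⊤ : Submodule R (Fin n → R)) ∧
    Nonempty (((Fin m → R) ⧸ LinearMap.range f) ≃ₗ[R] M) ∧
    Nonempty ((Module.Dual R (Fin n → R) ⧸ LinearMap.range f.dualMap) ≃ₗ[R] T)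

end

universe u

open CochainComplex.HomComplex in
lemma CategoryTheory.ProjectiveResolution.extMk_zero_injective {C : Type*} [Category* C] [Abelian C]
    [HasExt C]
    {X : C} (P : ProjectiveResolution X) {Y : C} (f : P.complex.X 0 ⟶ Y)
    (hf : P.complex.d 1 0 ≫ f = 0) (h : P.extMk f 1 rfl hf = 0) : f = 0 := by
  rw [← P.extEquivCohomologyClass.apply_eq_iff_eq,
    P.extEquivCohomologyClass_extMk, P.extEquivCohomologyClass_zero,
    CohomologyClass.mk_eq_zero_iff, Cocycle.toSingleMk_mem_coboundaries_iff _ _ _ _ _ 1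
      (by lia)] at h
  obtain ⟨g, hg⟩ := h
  have hz : Limits.IsZero (P.cochainComplex.X 1) := by
    exact P.cochainComplex.isZero_of_isStrictlyLE 0 1
  rw [hz.eq_of_src g 0, Limits.comp_zero] at hg
  have := congrArg (fun t => (P.cochainComplexXIso (-(0:ℕ)) 0 rfl).inv ≫ t) hg
  simpa using this.symm

/-- The `n`-cocycles of `Hom(P, Y)`, for a projective resolution `P` of `X`. -/
noncomputable abbrev CategoryTheory.ProjectiveResolution.cocycles {R : Type u} [CommRing R]
    {X : ModuleCat.{u} R} (P : ProjectiveResolution X) (Y : ModuleCat.{u} R) (n : ℕ) :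
    Submodule R (P.complex.X n ⟶ Y) :=
  LinearMap.ker (Linear.leftComp R Y (P.complex.d (n + 1) n))

/-- The cocycles of `Hom(P, Y)`, for a projective resolution `P` of `X`, map linearly onto
`Ext X Y n`. -/
noncomputable def CategoryTheory.ProjectiveResolution.cocyclesToExt {R : Type u} [CommRing R]
    {X : ModuleCat.{u} R} (P : ProjectiveResolution X) (Y : ModuleCat.{u} R) (n : ℕ) :
    P.cocycles Y n →ₗ[R] Abelian.Ext X Y n where
  toFun f := P.extMk f.1 (n + 1) rfl f.2
  map_add' f g := (P.add_extMk _ _ _ _ _ _).symm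
  map_smul' r f := by
    refine Eq.trans ?_ (((Abelian.Ext.smul_eq_comp_mk₀ _ _).trans
      (P.extMk_comp_mk₀ f.1 (n + 1) rfl f.2 (r • 𝟙 Y))).symm)
    congr 1

lemma CategoryTheory.ProjectiveResolution.cocyclesToExt_surjective {R : Type u} [CommRing R]
    {X : ModuleCat.{u} R} (P : ProjectiveResolution X) (Y : ModuleCat.{u} R) (n : ℕ) :
    Function.Surjective (P.cocyclesToExt Y n) := fun α ↦ by
  obtain ⟨f, hf, rfl⟩ := P.extMk_surjective α (n + 1) rfl
  exact ⟨⟨f, hf⟩, rfl⟩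

/-- The two definitions of `Ext` for modules agree. -/
lemma nonempty_ext_linearEquiv {R : Type u} [CommRing R] (X Y : ModuleCat.{u} R) (n : ℕ) :
    Nonempty (((Ext R (ModuleCat R) n).obj (Opposite.op X)).obj Y ≃ₗ[R] Abelian.Ext X Y n) := by
  let P := projectiveResolution X
  let K := P.complex.linearYonedaObj R Y
  obtain ⟨p, hp⟩ : ∃ p, (ComplexShape.up ℕ).prev n = p := ⟨_, rfl⟩
  let S := K.sc' p n (n + 1)
  have e₁ : ((Ext R (ModuleCat R) n).obj (Opposite.op X)).obj Y ≅ S.moduleCatLeftHomologyData.H :=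
    P.isoExt n Y ≪≫ ShortComplex.homologyMapIso (K.isoSc' p n (n + 1) hp (by simp)) ≪≫
      S.moduleCatHomologyIso
  let φ : LinearMap.ker S.g.hom →ₗ[R] Abelian.Ext X Y n := P.cocyclesToExt Y n
  have hφ : Function.Surjective φ := P.cocyclesToExt_surjective Y n
  have hker : LinearMap.range S.moduleCatToCycles = LinearMap.ker φ := by
    ext ⟨f, hf⟩
    constructor
    · rintro ⟨g, hg⟩
      change P.complex.X p ⟶ Y at g
      change P.complex.X n ⟶ Y at f
      have hg' : P.complex.d n p ≫ g = f := congrArg Subtype.val hg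
      change P.extMk f (n + 1) rfl hf = 0
      obtain _ | q := n
      · obtain rfl : 0 = p := by rw [← hp, CochainComplex.prev_nat_zero]
        rw [P.complex.shape 0 0 (by simp), Limits.zero_comp] at hg'
        subst hg'
        exact map_zero (P.cocyclesToExt Y 0)
      · obtain rfl : q = p := by rw [← hp, CochainComplex.prev_nat_succ]
        exact (P.extMk_eq_zero_iff f _ rfl hf q rfl).2 ⟨g, hg'⟩
    · intro h
      have h' : P.extMk f (n + 1) rfl hf = 0 := h
      obtain _ | q := n
      · have := P.extMk_zero_injective f hf h'
        subst this
        exact Submodule.zero_mem _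
      · obtain rfl : q = p := by rw [← hp, CochainComplex.prev_nat_succ]
        obtain ⟨g, hg⟩ := (P.extMk_eq_zero_iff f _ rfl hf q rfl).1 h'
        exact ⟨g, Subtype.ext hg⟩
  exact ⟨e₁.toLinearEquiv ≪≫ₗ Submodule.quotEquivOfEq _ _ hker ≪≫ₗ
    φ.quotKerEquivOfSurjective hφ⟩

/-- The `n`-th Ext module of two `R`-modules. -/
abbrev ModExt (R : Type u) [CommRing R] (n : ℕ) (X Y : Type u) [AddCommGroup X] [Module R X]
    [AddCommGroup Y] [Module R Y] : Type u :=
  Abelian.Ext (ModuleCat.of R X) (ModuleCat.of R Y) n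

namespace ModExt

variable {R : Type u} [CommRing R] {A B C W V : Type u} [AddCommGroup A] [Module R A]
  [AddCommGroup B] [Module R B] [AddCommGroup C] [Module R C] [AddCommGroup W] [Module R W]
  [AddCommGroup V] [Module R V] {n : ℕ}

/-- The map on Ext induced by a linear map in the first variable. -/
noncomputable def pre (n : ℕ) (W : Type u) [AddCommGroup W] [Module R W] (f : A →ₗ[R] B) :
    ModExt R n B W →ₗ[R] ModExt R n A W :=
  (Abelian.Ext.mk₀ (ModuleCat.ofHom f)).precompOfLinear R (ModuleCat.of R W) (zero_add n)

/-- The map on Ext induced by a linear map in the second variable. -/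
noncomputable def post (n : ℕ) (A : Type u) [AddCommGroup A] [Module R A] (f : V →ₗ[R] W) :
    ModExt R n A V →ₗ[R] ModExt R n A W :=
  (Abelian.Ext.mk₀ (ModuleCat.ofHom f)).postcompOfLinear R (ModuleCat.of R A) (add_zero n)

lemma pre_apply (f : A →ₗ[R] B) (x : ModExt R n B W) :
    pre n W f x = (Abelian.Ext.mk₀ (ModuleCat.ofHom f)).comp x (zero_add n) := rfl

lemma post_apply (f : V →ₗ[R] W) (x : ModExt R n A V) :
    post n A f x = x.comp (Abelian.Ext.mk₀ (ModuleCat.ofHom f)) (add_zero n) := rfl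

lemma pre_comp_apply (f : A →ₗ[R] B) (g : B →ₗ[R] C) (x : ModExt R n C W) :
    pre n W (g ∘ₗ f) x = pre n W f (pre n W g x) := by
  simp [pre_apply]

@[simp]
lemma pre_id_apply (x : ModExt R n A W) : pre n W (LinearMap.id : A →ₗ[R] A) x = x := by
  simp [pre_apply]

lemma pre_add (f g : A →ₗ[R] B) : pre n W (f + g) = pre n W f + pre n W g := by
  ext x
  simp [pre_apply, ModuleCat.ofHom_add, Abelian.Ext.mk₀_add]

@[simp]
lemma pre_zero : pre n W (0 : A →ₗ[R] B) = 0 := by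
  ext x
  simp [pre_apply]

lemma pre_smul (r : R) (f : A →ₗ[R] B) : pre n W (r • f) = r • pre n W f := by
  ext x
  have : ModuleCat.ofHom (r • f) = r • ModuleCat.ofHom f := rfl
  simp [pre_apply, this, Abelian.Ext.mk₀_smul]

/-- Ext is linear in linear maps of the first variable. -/
noncomputable def preₗ (n : ℕ) (A B W : Type u) [AddCommGroup A] [Module R A]
    [AddCommGroup B] [Module R B] [AddCommGroup W] [Module R W] :
    (A →ₗ[R] B) →ₗ[R] ModExt R n B W →ₗ[R] ModExt R n A W where
  toFun := pre n W
  map_add' := pre_add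
  map_smul' := pre_smul

lemma post_smul_id (r : R) (x : ModExt R n A W) :
    post n A (r • (LinearMap.id : W →ₗ[R] W)) x = r • x := by
  have : ModuleCat.ofHom (r • (LinearMap.id : W →ₗ[R] W)) = r • 𝟙 (ModuleCat.of R W) := rfl
  rw [post_apply, this, Abelian.Ext.mk₀_smul, Abelian.Ext.comp_smul, Abelian.Ext.comp_mk₀_id]

lemma post_comp_apply (f : A →ₗ[R] B) (g : B →ₗ[R] C) (x : ModExt R n W A) :
    post n W (g ∘ₗ f) x = post n W g (post n W f x) := by
  simp [post_apply]

@[simp]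
lemma post_id_apply (x : ModExt R n W A) : post n W (LinearMap.id : A →ₗ[R] A) x = x := by
  simp [post_apply]

/-- Isomorphic modules have isomorphic Ext modules, first variable. -/
noncomputable def preEquiv (n : ℕ) (W : Type u) [AddCommGroup W] [Module R W] (e : A ≃ₗ[R] B) :
    ModExt R n B W ≃ₗ[R] ModExt R n A W :=
  .ofLinearMap (pre n W e.toLinearMap) (pre n W e.symm.toLinearMap)
    (by ext x; simp [← pre_comp_apply]) (by ext x; simp [← pre_comp_apply])

/-- Isomorphic modules have isomorphic Ext modules, second variable. -/
noncomputable def postEquiv (n : ℕ) (W : Type u) [AddCommGroup W] [Module R W] (e : A ≃ₗ[R] B) :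
    ModExt R n W A ≃ₗ[R] ModExt R n W B :=
  .ofLinearMap (post n W e.toLinearMap) (post n W e.symm.toLinearMap)
    (by ext x; simp [← post_comp_apply]) (by ext x; simp [← post_comp_apply])

/-- `Ext⁰` is `Hom`. -/
noncomputable def zeroEquiv (A W : Type u) [AddCommGroup A] [Module R A] [AddCommGroup W]
    [Module R W] : ModExt R 0 A W ≃ₗ[R] (A →ₗ[R] W) :=
  Abelian.Ext.linearEquiv₀ ≪≫ₗ ModuleCat.homLinearEquiv

lemma subsingleton_of_subsingleton_left [Subsingleton A] : Subsingleton (ModExt R n A W) :=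
  subsingleton_of_forall_eq 0 fun x ↦ by
    rw [← pre_id_apply x, Subsingleton.elim (LinearMap.id : A →ₗ[R] A) 0, pre_zero,
      LinearMap.zero_apply]

lemma subsingleton_of_projective [Module.Projective R A] :
    Subsingleton (ModExt R (n + 1) A W) := by
  have : Projective (ModuleCat.of R A) := (IsProjective.iff_projective A).1 inferInstance
  exact subsingleton_of_forall_eq 0 fun x ↦ x.eq_zero_of_projective

instance [IsNoetherianRing R] [Module.Finite R A] [Module.Finite R W] :
    Module.Finite R (ModExt R n A W) := by
  exact ModuleCat.finite_ext R (ModuleCat.of R A) (ModuleCat.of R W) n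

section Sequence

variable {f : A →ₗ[R] B} {g : B →ₗ[R] C}

lemma shortExact (hf : Function.Injective f) (hfg : Function.Exact f g)
    (hg : Function.Surjective g) :
    (ShortComplex.mk (ModuleCat.ofHom f) (ModuleCat.ofHom g)
      (by ext x; exact hfg.apply_apply_eq_zero x)).ShortExact :=
  ModuleCat.shortComplex_shortExact _ hfg hf hg

variable (W n)

lemma exact_pre (hf : Function.Injective f) (hfg : Function.Exact f g)
    (hg : Function.Surjective g) : Function.Exact (pre n W g) (pre n W f) := fun x ↦ by
  constructor
  · intro h
    exact Abelian.Ext.contravariant_sequence_exact₂ (shortExact hf hfg hg) _ x h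
  · rintro ⟨y, rfl⟩
    rw [← pre_comp_apply, hfg.linearMap_comp_eq_zero, pre_zero, LinearMap.zero_apply]

lemma exists_pre_connecting (hf : Function.Injective f) (hfg : Function.Exact f g)
    (hg : Function.Surjective g) :
    ∃ δ : ModExt R n A W →ₗ[R] ModExt R (n + 1) C W,
      Function.Exact (pre n W f) δ ∧ Function.Exact δ (pre (n + 1) W g) := by
  have hS := shortExact hf hfg hg
  refine ⟨hS.extClass.precompOfLinear R (ModuleCat.of R W) (add_comm 1 n), fun x ↦ ?_, fun x ↦ ?_⟩
  · constructor
    · intro h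
      exact Abelian.Ext.contravariant_sequence_exact₁ hS _ x (add_comm 1 n) h
    · rintro ⟨y, rfl⟩
      exact hS.extClass_comp_assoc _ (h := add_comm 1 n)
  · constructor
    · intro h
      exact Abelian.Ext.contravariant_sequence_exact₃ hS _ x h (add_comm 1 n)
    · rintro ⟨y, rfl⟩
      exact hS.comp_extClass_assoc y (add_comm 1 n)

lemma exact_post (hf : Function.Injective f) (hfg : Function.Exact f g)
    (hg : Function.Surjective g) : Function.Exact (post n W f) (post n W g) := fun x ↦ by
  constructor
  · intro h
    exact Abelian.Ext.covariant_sequence_exact₂ _ (shortExact hf hfg hg) x h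
  · rintro ⟨y, rfl⟩
    rw [← post_comp_apply, hfg.linearMap_comp_eq_zero]
    simp [post_apply]

lemma exists_post_connecting (hf : Function.Injective f) (hfg : Function.Exact f g)
    (hg : Function.Surjective g) :
    ∃ δ : ModExt R n W C →ₗ[R] ModExt R (n + 1) W A,
      Function.Exact (post n W g) δ ∧ Function.Exact δ (post (n + 1) W f) := by
  have hS := shortExact hf hfg hg
  refine ⟨hS.extClass.postcompOfLinear R (ModuleCat.of R W) rfl, fun x ↦ ?_, fun x ↦ ?_⟩
  · constructor
    · intro h
      exact Abelian.Ext.covariant_sequence_exact₃ _ hS x rfl h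
    · rintro ⟨y, rfl⟩
      change (y.comp (Abelian.Ext.mk₀ (ModuleCat.ofHom g)) (add_zero n)).comp hS.extClass rfl = 0
      rw [Abelian.Ext.comp_assoc_of_second_deg_zero, hS.comp_extClass, Abelian.Ext.comp_zero]
  · constructor
    · intro h
      exact Abelian.Ext.covariant_sequence_exact₁ _ hS x h rfl
    · rintro ⟨y, rfl⟩
      change (y.comp hS.extClass rfl).comp (Abelian.Ext.mk₀ (ModuleCat.ofHom f)) (add_zero _) = 0
      rw [Abelian.Ext.comp_assoc_of_third_deg_zero, hS.extClass_comp, Abelian.Ext.comp_zero]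

lemma pre_injective_of_surjective (hg : Function.Surjective g) :
    Function.Injective (pre 0 W g) := by
  rw [injective_iff_map_eq_zero]
  intro x hx
  rw [pre_apply] at hx
  obtain ⟨h, rfl⟩ := (Abelian.Ext.mk₀_bijective _ _).2 x
  rw [Abelian.Ext.mk₀_comp_mk₀, Abelian.Ext.mk₀_eq_zero_iff] at hx
  have : Epi (ModuleCat.ofHom g) := (ModuleCat.epi_iff_surjective _).2 hg
  rw [Abelian.Ext.mk₀_eq_zero_iff]
  exact Limits.zero_of_epi_comp _ hx

end Sequence

end ModExt

section Exact

variable {R : Type*} [CommRing R] {A B C D : Type*} [AddCommGroup A] [Module R A]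
  [AddCommGroup B] [Module R B] [AddCommGroup C] [Module R C] {f : A →ₗ[R] B} {g : B →ₗ[R] C}

lemma Function.Exact.injective_of_subsingleton (h : Function.Exact f g) [Subsingleton A] :
    Function.Injective g := by
  rw [injective_iff_map_eq_zero]
  intro x hx
  obtain ⟨y, rfl⟩ := (h x).1 hx
  rw [Subsingleton.elim y 0, map_zero]

lemma Function.Exact.surjective_of_subsingleton (h : Function.Exact f g) [Subsingleton C] :
    Function.Surjective f :=
  fun x ↦ (h x).1 (Subsingleton.elim _ _)

lemma Function.Exact.subsingleton (h : Function.Exact f g) [Subsingleton A] [Subsingleton C] :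
    Subsingleton B := h.injective_of_subsingleton.subsingleton

end Exact

namespace ModExt

variable {R : Type u} [CommRing R] {A B C W V : Type u} [AddCommGroup A] [Module R A]
  [AddCommGroup B] [Module R B] [AddCommGroup C] [Module R C] [AddCommGroup W] [Module R W]
  [AddCommGroup V] [Module R V] {f : A →ₗ[R] B} {g : B →ₗ[R] C}
  (hf : Function.Injective f) (hfg : Function.Exact f g) (hg : Function.Surjective g)

include hf hfg hg

lemma nonempty_equiv_connecting (n : ℕ) (h₁ : Subsingleton (ModExt R n B W))
    (h₂ : Subsingleton (ModExt R (n + 1) B W)) :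
    Nonempty (ModExt R n A W ≃ₗ[R] ModExt R (n + 1) C W) := by
  obtain ⟨δ, hδ₁, hδ₂⟩ := exists_pre_connecting W n hf hfg hg
  exact ⟨.ofBijective δ ⟨hδ₁.injective_of_subsingleton, hδ₂.surjective_of_subsingleton⟩⟩

lemma pre_surjective_of_succ (n : ℕ) (h : Subsingleton (ModExt R (n + 1) C W)) :
    Function.Surjective (pre n W f) := by
  obtain ⟨δ, hδ₁, hδ₂⟩ := exists_pre_connecting W n hf hfg hg
  exact hδ₁.surjective_of_subsingleton

lemma pre_injective_of_pred (n : ℕ) (h : ∀ m, m + 1 = n → Subsingleton (ModExt R m A W)) :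
    Function.Injective (pre n W g) := by
  obtain _ | n := n
  · exact pre_injective_of_surjective _ hg
  · have := h n rfl
    obtain ⟨δ, hδ₁, hδ₂⟩ := exists_pre_connecting W n hf hfg hg
    exact hδ₂.injective_of_subsingleton

/-- If Ext of the quotient vanishes in two consecutive degrees, restriction is an isomorphism. -/
lemma nonempty_equiv_left (n : ℕ) (h₁ : Subsingleton (ModExt R n C W))
    (h₂ : Subsingleton (ModExt R (n + 1) C W)) :
    Nonempty (ModExt R n B W ≃ₗ[R] ModExt R n A W) :=
  ⟨.ofBijective (pre n W f) ⟨(exact_pre W n hf hfg hg).injective_of_subsingleton,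
    pre_surjective_of_succ hf hfg hg n h₂⟩⟩

/-- If Ext of the submodule vanishes in two consecutive degrees, inflation is an isomorphism. -/
lemma nonempty_equiv_right (n : ℕ) (h₁ : ∀ m, m + 1 = n → Subsingleton (ModExt R m A W))
    (h₂ : Subsingleton (ModExt R n A W)) :
    Nonempty (ModExt R n C W ≃ₗ[R] ModExt R n B W) :=
  ⟨.ofBijective (pre n W g) ⟨pre_injective_of_pred hf hfg hg n h₁,
    (exact_pre W n hf hfg hg).surjective_of_subsingleton⟩⟩

lemma subsingleton_middle (n : ℕ) (h₁ : Subsingleton (ModExt R n A W))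
    (h₂ : Subsingleton (ModExt R n C W)) : Subsingleton (ModExt R n B W) :=
  (exact_pre W n hf hfg hg).subsingleton

lemma subsingleton_left (n : ℕ) (h₁ : Subsingleton (ModExt R n B W))
    (h₂ : Subsingleton (ModExt R (n + 1) C W)) : Subsingleton (ModExt R n A W) :=
  (pre_surjective_of_succ hf hfg hg n h₂).subsingleton

lemma subsingleton_right (n : ℕ) (h₁ : ∀ m, m + 1 = n → Subsingleton (ModExt R m A W))
    (h₂ : Subsingleton (ModExt R n B W)) : Subsingleton (ModExt R n C W) :=
  (pre_injective_of_pred hf hfg hg n h₁).subsingleton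

lemma subsingleton_post_right (n : ℕ) (h₁ : Subsingleton (ModExt R n W B))
    (h₂ : Subsingleton (ModExt R (n + 1) W A)) : Subsingleton (ModExt R n W C) := by
  obtain ⟨δ, hδ₁, hδ₂⟩ := exists_post_connecting W n hf hfg hg
  exact hδ₁.subsingleton

end ModExt

namespace ModExt

lemma subsingleton_post_left {R : Type u} [CommRing R] {A B C W : Type u} [AddCommGroup A]
    [Module R A] [AddCommGroup B] [Module R B] [AddCommGroup C] [Module R C] [AddCommGroup W]
    [Module R W] {f : A →ₗ[R] B} {g : B →ₗ[R] C}
    (hf : Function.Injective f) (hfg : Function.Exact f g) (hg : Function.Surjective g) (n : ℕ)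
    (h₁ : Subsingleton (ModExt R n W C)) (h₂ : Subsingleton (ModExt R (n + 1) W B)) :
    Subsingleton (ModExt R (n + 1) W A) := by
  obtain ⟨δ, hδ₁, hδ₂⟩ := exists_post_connecting W n hf hfg hg
  exact hδ₂.subsingleton

lemma subsingleton_of_hasInjDimLE {R : Type} [CommRing R] (n : ℕ) :
    ∀ (W : Type) [AddCommGroup W] [Module R W], hasInjDimLE R n W →
    ∀ (X : Type) [AddCommGroup X] [Module R X] (j : ℕ), n < j → Subsingleton (ModExt R j X W) := by
  have inj (W : Type) [AddCommGroup W] [Module R W] (hW : Module.Injective R W)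
      (X : Type) [AddCommGroup X] [Module R X] (j : ℕ) : Subsingleton (ModExt R (j + 1) X W) := by
    have : Injective (ModuleCat.of R W) := Module.injective_object_of_injective_module R W
    exact subsingleton_of_forall_eq 0 fun x ↦ x.eq_zero_of_injective
  induction n with
  | zero =>
    intro W _ _ h X _ _ j hj
    obtain ⟨j, rfl⟩ := Nat.exists_eq_add_of_lt hj
    exact inj W h X _
  | succ n ih =>
    rintro W _ _ ⟨I, _, _, f, hI, hf, hn⟩ X _ _ j hj
    obtain ⟨j, rfl⟩ : ∃ m, j = m + 1 := ⟨j - 1, by lia⟩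
    exact subsingleton_post_left hf (f.exact_map_mkQ_range) (Submodule.mkQ_surjective _) j
      (ih _ hn X j (by lia)) (inj I hI X j)

lemma pre_lsmul {R : Type u} [CommRing R] {W : Type u} [AddCommGroup W] [Module R W]
    (n : ℕ) (X : Type u) [AddCommGroup X] [Module R X] (x : R)
    (a : ModExt R n X W) : pre n W (LinearMap.lsmul R X x) a = x • a := by
  have : LinearMap.lsmul R X x = x • LinearMap.id := rfl
  rw [this, pre_smul, LinearMap.smul_apply, pre_id_apply]

lemma post_lsmul {R : Type u} [CommRing R] {W : Type u} [AddCommGroup W] [Module R W]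
    (n : ℕ) (X : Type u) [AddCommGroup X] [Module R X] (x : R)
    (a : ModExt R n X W) : post n X (LinearMap.lsmul R W x) a = x • a :=
  post_smul_id x a

lemma smul_eq_zero_left {R : Type u} [CommRing R] {W : Type u} [AddCommGroup W] [Module R W]
    (n : ℕ) (X : Type u) [AddCommGroup X] [Module R X] (x : R)
    (hx : x ∈ Module.annihilator R X) (a : ModExt R n X W) : x • a = 0 := by
  have : LinearMap.lsmul R X x = 0 := by
    ext y
    exact Module.mem_annihilator.1 hx y
  rw [← pre_lsmul, this, pre_zero, LinearMap.zero_apply]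

/-- Ext into `W` of a finite power of `N` vanishes if Ext of `N` does. -/
lemma subsingleton_pi {R : Type u} [CommRing R] {N W : Type u} [AddCommGroup N] [Module R N]
    [AddCommGroup W] [Module R W] (n m : ℕ) (h : Subsingleton (ModExt R n N W)) :
    Subsingleton (ModExt R n (Fin m → N) W) := by
  refine subsingleton_of_forall_eq 0 fun x ↦ ?_
  have hid : (LinearMap.id : (Fin m → N) →ₗ[R] (Fin m → N)) =
      ∑ i, LinearMap.single R (fun _ ↦ N) i ∘ₗ LinearMap.proj i := by
    refine LinearMap.ext fun v ↦ ?_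
    simp [LinearMap.sum_apply, Finset.univ_sum_single]
  rw [← pre_id_apply x]
  change preₗ n _ _ W LinearMap.id x = 0
  rw [hid, map_sum, LinearMap.sum_apply]
  refine Finset.sum_eq_zero fun i _ ↦ ?_
  change pre n W _ x = 0
  rw [pre_comp_apply, Subsingleton.elim (pre n W _ x) 0, map_zero]

end ModExt

section Regular

variable {R : Type u} [CommRing R]

open scoped Pointwise in
lemma IsSMulRegular.exact_lsmul_mkQ (x : R) (X : Type*) [AddCommGroup X] [Module R X] :
    Function.Exact (LinearMap.lsmul R X x) (Submodule.mkQ (x • (⊤ : Submodule R X))) := by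
  rw [LinearMap.exact_iff, Submodule.ker_mkQ]
  ext y
  simp [Submodule.mem_smul_pointwise_iff_exists]

variable [IsLocalRing R]

/-- A finite module on which an element of the maximal ideal acts surjectively is zero. -/
lemma subsingleton_of_smul_surjective {A : Type*} [AddCommGroup A] [Module R A]
    [Module.Finite R A] {x : R} (hx : x ∈ maximalIdeal R)
    (h : Function.Surjective (fun a : A ↦ x • a)) : Subsingleton A := by
  have : (⊤ : Submodule R A) = ⊥ := by
    refine Submodule.eq_bot_of_le_smul_of_le_jacobson_bot (maximalIdeal R) ⊤
      Module.Finite.fg_top (fun a _ ↦ ?_) (IsLocalRing.maximalIdeal_le_jacobson _)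
    obtain ⟨b, rfl⟩ := h a
    exact Submodule.smul_mem_smul hx trivial
  exact (Submodule.subsingleton_iff R).1 (subsingleton_of_bot_eq_top this.symm)

end Regular

instance {R : Type*} [CommRing R] [IsLocalRing R] : IsSimpleModule R (R ⧸ maximalIdeal R) :=
  isSimpleModule_iff_isCoatom.2 (maximalIdeal.isMaximal R).out

section Vanishing

variable {R : Type u} [CommRing R] [IsNoetherianRing R] [IsLocalRing R]
  {W : Type u} [AddCommGroup W] [Module R W]

lemma exists_isSMulRegular_of_subsingleton_hom (X : Type u) [AddCommGroup X] [Module R X]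
    [Module.Finite R X] (h : Subsingleton ((R ⧸ maximalIdeal R) →ₗ[R] X)) :
    ∃ x ∈ maximalIdeal R, IsSMulRegular X x := by
  obtain ⟨x, hx, hreg⟩ := IsSMulRegular.subsingleton_linearMap_iff.1 h
  rw [Ideal.annihilator_quotient] at hx
  exact ⟨x, hx, hreg⟩

namespace ModExt

lemma subsingleton_of_quotSMulTop [Module.Finite R W] (X : Type u) [AddCommGroup X] [Module R X]
    [Module.Finite R X] {x : R} (hx : x ∈ maximalIdeal R) (hreg : IsSMulRegular X x) (n : ℕ)
    (h : Subsingleton (ModExt R (n + 1) (QuotSMulTop x X) W)) : Subsingleton (ModExt R n X W) := by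
  have := pre_surjective_of_succ (f := LinearMap.lsmul R X x) hreg
    (IsSMulRegular.exact_lsmul_mkQ x X) (Submodule.mkQ_surjective _) n h
  refine subsingleton_of_smul_surjective hx fun a ↦ ?_
  obtain ⟨b, hb⟩ := this a
  exact ⟨b, by rw [← hb, pre_lsmul]⟩

/-- If all Ext modules into `W` vanish above degree `d`, then Ext modules of a module of depth at
least `t` vanish above degree `d - t`. -/
lemma subsingleton_of_depth [Module.Finite R W] (d : ℕ)
    (hW : ∀ (X : Type u) [AddCommGroup X] [Module R X] [Module.Finite R X] (j : ℕ), d < j →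
      Subsingleton (ModExt R j X W)) (t : ℕ) :
    ∀ (X : Type u) [AddCommGroup X] [Module R X] [Module.Finite R X],
      (∀ i < t, Subsingleton (ModExt R i (R ⧸ maximalIdeal R) X)) →
      ∀ j, d < j + t → Subsingleton (ModExt R j X W) := by
  induction t with
  | zero => intro X _ _ _ _ j hj; exact hW X j hj
  | succ t ih =>
    intro X _ _ _ hX j hj
    obtain ⟨x, hx, hreg⟩ := exists_isSMulRegular_of_subsingleton_hom X
      ((zeroEquiv _ _).symm.toEquiv.subsingleton_congr.2 (hX 0 (by lia)))
    refine subsingleton_of_quotSMulTop X hx hreg j (ih _ (fun i hi ↦ ?_) _ (by lia))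
    exact subsingleton_post_right (f := LinearMap.lsmul R X x) hreg
      (IsSMulRegular.exact_lsmul_mkQ x X) (Submodule.mkQ_surjective _) i
      (hX i (by lia)) (hX (i + 1) (by lia))

lemma subsingleton_of_succ_of_residue [Module.Finite R W] (r : ℕ)
    (hW : ∀ (X : Type u) [AddCommGroup X] [Module R X] [Module.Finite R X],
      Subsingleton (ModExt R (r + 1) X W))
    (hk : Subsingleton (ModExt R r (R ⧸ maximalIdeal R) W))
    (X : Type u) [AddCommGroup X] [Module R X] [hX : Module.Finite R X] :
    Subsingleton (ModExt R r X W) := by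
  induction hX using IsNoetherianRing.induction_on_isQuotientEquivQuotientPrime R with
  | subsingleton N => exact subsingleton_of_subsingleton_left
  | quotient N p e =>
    refine (preEquiv r W e).toEquiv.subsingleton_congr.1 ?_
    by_cases hp : p.asIdeal = maximalIdeal R
    · rw [hp]; exact hk
    obtain ⟨x, hxm, hxp⟩ : ∃ x ∈ maximalIdeal R, x ∉ p.asIdeal := by
      by_contra! h
      exact hp (le_antisymm (le_maximalIdeal p.2.ne_top) h)
    refine subsingleton_of_quotSMulTop (R ⧸ p.asIdeal) hxm ?_ r (hW _)
    have hreg : ∀ y : R ⧸ p.asIdeal, x • y = 0 → y = 0 := by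
      rintro ⟨y⟩ hy
      have : x * y ∈ p.asIdeal := Ideal.Quotient.eq_zero_iff_mem.1 hy
      exact Ideal.Quotient.eq_zero_iff_mem.2 ((p.2.mem_or_mem this).resolve_left hxp)
    exact fun a b hab ↦ sub_eq_zero.1 (hreg _ (by rw [smul_sub, sub_eq_zero]; exact hab))
  | exact N₁ N₂ N₃ f g hf hg hfg h₁ h₃ => exact subsingleton_middle hf hfg hg r h₁ h₃

lemma nontrivial_quotSMulTop {R : Type u} [CommRing R] [IsLocalRing R] (X : Type u)
    [AddCommGroup X] [Module R X]
    {x : R} (hx : x ∈ maximalIdeal R) (hreg : IsSMulRegular X x) (n : ℕ)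
    (h : Nontrivial (ModExt R (n + 1) (R ⧸ maximalIdeal R) X)) :
    Nontrivial (ModExt R n (R ⧸ maximalIdeal R) (QuotSMulTop x X)) := by
  by_contra h'
  rw [not_nontrivial_iff_subsingleton] at h'
  obtain ⟨δ, -, hδ⟩ := exists_post_connecting (R ⧸ maximalIdeal R) n
    (f := LinearMap.lsmul R X x) hreg
    (IsSMulRegular.exact_lsmul_mkQ x X) (Submodule.mkQ_surjective _)
  have hinj := hδ.injective_of_subsingleton
  have : Subsingleton (ModExt R (n + 1) (R ⧸ maximalIdeal R) X) := by
    refine subsingleton_of_forall_eq 0 fun a ↦ hinj ?_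
    rw [map_zero, post_lsmul]
    exact smul_eq_zero_left _ _ _ (by rwa [Ideal.annihilator_quotient]) _
  exact not_subsingleton _ this

lemma le_add_of_nontrivial (r : ℕ)
    (hW : ∀ (X : Type u) [AddCommGroup X] [Module R X] [Module.Finite R X],
      Subsingleton (ModExt R (r + 1) X W))
    (hk : Nontrivial (ModExt R r (R ⧸ maximalIdeal R) W)) (t : ℕ) :
    ∀ (X : Type u) [AddCommGroup X] [Module R X] [Module.Finite R X] (s : ℕ),
      Nontrivial (ModExt R t (R ⧸ maximalIdeal R) X) →
      (∀ j, s < j → Subsingleton (ModExt R j X W)) → r ≤ s + t := by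
  have hom (X : Type u) [AddCommGroup X] [Module R X] [Module.Finite R X] (s : ℕ)
      (h : ¬ Subsingleton ((R ⧸ maximalIdeal R) →ₗ[R] X))
      (hs : ∀ j, s < j → Subsingleton (ModExt R j X W)) : r ≤ s := by
    by_contra! hr
    rw [not_subsingleton_iff_nontrivial] at h
    obtain ⟨f, hf⟩ := exists_ne (0 : (R ⧸ maximalIdeal R) →ₗ[R] X)
    have hinj := LinearMap.injective_of_ne_zero hf
    have := hs r hr
    have := (pre_surjective_of_succ hinj f.exact_map_mkQ_range (Submodule.mkQ_surjective _) r
      (hW _)).subsingleton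
    exact not_subsingleton _ this
  induction t with
  | zero =>
    intro X _ _ _ s ht hs
    refine hom _ _ (fun h ↦ ?_) hs
    exact not_subsingleton _ ((zeroEquiv _ _).toEquiv.subsingleton_congr.2 h)
  | succ t ih =>
    intro X _ _ _ s ht hs
    by_cases h : Subsingleton ((R ⧸ maximalIdeal R) →ₗ[R] X)
    · obtain ⟨x, hx, hreg⟩ := exists_isSMulRegular_of_subsingleton_hom X h
      have := ih (QuotSMulTop x X) (s + 1) (nontrivial_quotSMulTop X hx hreg t ht) fun j hj ↦
        subsingleton_right (f := LinearMap.lsmul R X x) hreg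
          (IsSMulRegular.exact_lsmul_mkQ x X) (Submodule.mkQ_surjective _) j
          (fun m hm ↦ hs m (by lia)) (hs j (by lia))
      lia
    · exact (hom X s h fun j hj ↦ hs j hj).trans (by lia)

/-- A finite module of finite injective dimension has injective dimension at most the depth of the
ring, as far as Ext of finite modules is concerned. -/
lemma subsingleton_of_lt_depth [Module.Finite R W] (d s : ℕ)
    (hR : Nontrivial (ModExt R d (R ⧸ maximalIdeal R) R))
    (hW : ∀ (X : Type u) [AddCommGroup X] [Module R X] [Module.Finite R X] (j : ℕ), s < j →
      Subsingleton (ModExt R j X W))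
    (X : Type u) [AddCommGroup X] [Module R X] [Module.Finite R X] (j : ℕ) (hj : d < j) :
    Subsingleton (ModExt R j X W) := by
  induction s with
  | zero => exact hW X j (by lia)
  | succ s ih =>
    by_cases hs : s < d
    · exact hW X j (by lia)
    refine ih fun X _ _ _ j hj ↦ ?_
    obtain hj' | rfl : s + 1 < j ∨ s + 1 = j := by lia
    · exact hW X j hj'
    refine subsingleton_of_succ_of_residue (s + 1) (fun X _ _ _ ↦ hW X _ (by lia)) ?_ X
    by_contra hk
    rw [not_subsingleton_iff_nontrivial] at hk
    have := le_add_of_nontrivial (s + 1) (fun X _ _ _ ↦ hW X _ (by lia)) hk d R 0 hR fun j hj ↦ by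
      obtain ⟨j, rfl⟩ : ∃ m, j = m + 1 := ⟨j - 1, by lia⟩
      exact subsingleton_of_projective
    lia

lemma subsingleton_of_isFiniteLength {R : Type u} [CommRing R] [IsLocalRing R]
    {W : Type u} [AddCommGroup W] [Module R W] (n : ℕ)
    (hk : Subsingleton (ModExt R n (R ⧸ maximalIdeal R) W))
    (L : Type u) [AddCommGroup L] [Module R L] (hL : IsFiniteLength R L) :
    Subsingleton (ModExt R n L W) := by
  induction hL with
  | of_subsingleton => exact subsingleton_of_subsingleton_left
  | @of_simple_quotient M _ _ N _ _ ih =>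
    obtain ⟨I, hI, ⟨e⟩⟩ := isSimpleModule_iff_quot_maximal.1 ‹IsSimpleModule R (M ⧸ N)›
    obtain rfl := IsLocalRing.eq_maximalIdeal hI
    exact subsingleton_middle N.injective_subtype (LinearMap.exact_subtype_mkQ N)
      N.mkQ_surjective n ih ((preEquiv n W e).toEquiv.subsingleton_congr.1 hk)

end ModExt

end Vanishing

/-- A linear map factors through a surjection whose kernel it kills. -/
lemma exists_comp_eq_of_ker_le {R : Type*} [CommRing R] {A B C : Type*} [AddCommGroup A]
    [Module R A] [AddCommGroup B] [Module R B] [AddCommGroup C] [Module R C] (p : A →ₗ[R] B)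
    (hp : Function.Surjective p) (f : A →ₗ[R] C) (h : LinearMap.ker p ≤ LinearMap.ker f) :
    ∃ g : B →ₗ[R] C, g ∘ₗ p = f := by
  refine ⟨(LinearMap.ker p).liftQ f h ∘ₗ (p.quotKerEquivOfSurjective hp).symm, ?_⟩
  ext a
  have : (p.quotKerEquivOfSurjective hp).symm (p a) = Submodule.Quotient.mk a := by
    rw [LinearEquiv.symm_apply_eq]
    rfl
  simp [this]

section Matlis

variable {R : Type u} [CommRing R] {W : Type u} [AddCommGroup W] [Module R W]
  {E : Type u} [AddCommGroup E] [Module R E]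

/-- An element of a module killed by `I` is a linear map from `R ⧸ I`. -/
noncomputable def elementMap (I : Ideal R) (L : Type u) [AddCommGroup L] [Module R L]
    (hI : I ≤ Module.annihilator R L) : L →ₗ[R] (R ⧸ I) →ₗ[R] L where
  toFun l := I.liftQ (LinearMap.toSpanSingleton R L l) fun r hr ↦
    Module.mem_annihilator.1 (hI hr) l
  map_add' l l' := by
    refine Submodule.linearMap_qext _ (LinearMap.ext fun r ↦ ?_)
    exact smul_add r l l'
  map_smul' r l := by
    refine Submodule.linearMap_qext _ (LinearMap.ext fun r' ↦ ?_)
    exact smul_comm r' r l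

/-- The pairing of a module killed by `I` with its Ext module in degree `d`, given by a functional
on the Ext module of `R ⧸ I`. -/
noncomputable def extPairing (d : ℕ) (I : Ideal R) (g : ModExt R d (R ⧸ I) W →ₗ[R] E)
    (L : Type u) [AddCommGroup L] [Module R L] (hI : I ≤ Module.annihilator R L) :
    L →ₗ[R] ModExt R d L W →ₗ[R] E :=
  LinearMap.compRight R g ∘ₗ ModExt.preₗ d (R ⧸ I) L W ∘ₗ elementMap I L hI

lemma extPairing_apply (d : ℕ) (I : Ideal R) (g : ModExt R d (R ⧸ I) W →ₗ[R] E)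
    (L : Type u) [AddCommGroup L] [Module R L] (hI : I ≤ Module.annihilator R L) (l : L)
    (x : ModExt R d L W) :
    extPairing d I g L hI l x = g (ModExt.pre d W (elementMap I L hI l) x) := rfl

lemma extPairing_map (d : ℕ) (I : Ideal R) (g : ModExt R d (R ⧸ I) W →ₗ[R] E)
    {L L' : Type u} [AddCommGroup L] [Module R L] [AddCommGroup L'] [Module R L']
    (hI : I ≤ Module.annihilator R L) (hI' : I ≤ Module.annihilator R L')
    (h : L →ₗ[R] L') (l : L) (x : ModExt R d L' W) :
    extPairing d I g L' hI' (h l) x = extPairing d I g L hI l (ModExt.pre d W h x) := by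
  rw [extPairing_apply, extPairing_apply, ← ModExt.pre_comp_apply]
  congr 3
  refine Submodule.linearMap_qext _ (LinearMap.ext fun r ↦ ?_)
  exact (map_smul h r l).symm

variable [IsLocalRing R]

/-- In an essential extension of the residue field, the socle is the residue field. -/
lemma mem_range_of_annihilated (j : (R ⧸ maximalIdeal R) →ₗ[R] E)
    (hess : ∀ W : Submodule R E, W ≠ ⊥ → W ⊓ LinearMap.range j ≠ ⊥) (v : E)
    (hv : ∀ r ∈ maximalIdeal R, r • v = 0) : v ∈ LinearMap.range j := by
  by_cases h : v = 0
  · rw [h]; exact zero_mem _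
  obtain ⟨w, hw, hw0⟩ := Submodule.exists_mem_ne_zero_of_ne_bot
    (hess (R ∙ v) (by simpa using h))
  obtain ⟨hw₁, hw₂⟩ := hw
  obtain ⟨r, rfl⟩ := Submodule.mem_span_singleton.1 hw₁
  have hr : IsUnit r := by
    by_contra hr
    exact hw0 (hv r hr)
  have := Submodule.smul_mem _ (hr.unit⁻¹ : Rˣ).1 hw₂
  rwa [smul_smul, IsUnit.val_inv_mul, one_smul] at this

variable (d : ℕ) (e : ModExt R d (R ⧸ maximalIdeal R) W ≃ₗ[R] (R ⧸ maximalIdeal R))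
  (j : (R ⧸ maximalIdeal R) →ₗ[R] E) (hj : Function.Injective j)
  (hess : ∀ W : Submodule R E, W ≠ ⊥ → W ⊓ LinearMap.range j ≠ ⊥)
  {I : Ideal R} (hIm : I ≤ maximalIdeal R) (g : ModExt R d (R ⧸ I) W →ₗ[R] E)
  (hg : ∀ x, g (ModExt.pre d W (Submodule.factor hIm) x) = j (e x))

include hj hess hg

lemma extPairing_residue_bijective (hI : I ≤ Module.annihilator R (R ⧸ maximalIdeal R)) :
    Function.Bijective (extPairing d I g (R ⧸ maximalIdeal R) hI) := by
  have h₁ (x) : extPairing d I g (R ⧸ maximalIdeal R) hI (Ideal.Quotient.mk _ 1) x = j (e x) := by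
    rw [← hg, extPairing_apply]
    congr 3
    refine Submodule.linearMap_qext _ (LinearMap.ext fun r ↦ ?_)
    change Ideal.Quotient.mk _ (r * 1) = Ideal.Quotient.mk _ r
    rw [mul_one]
  set x₀ := e.symm (Ideal.Quotient.mk _ 1) with hx₀
  constructor
  · refine LinearMap.injective_of_ne_zero fun h ↦ ?_
    have := h₁ x₀
    rw [h, LinearMap.zero_apply, LinearMap.zero_apply, hx₀, e.apply_symm_apply, eq_comm,
      map_eq_zero_iff _ hj, map_one] at this
    exact one_ne_zero this
  · intro ψ
    have hx (x) : ∃ r : R, x = r • x₀ := by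
      obtain ⟨r, hr⟩ := Ideal.Quotient.mk_surjective (e x)
      refine ⟨r, e.injective ?_⟩
      rw [map_smul, hx₀, e.apply_symm_apply, ← hr]
      change _ = Ideal.Quotient.mk _ (r * 1)
      rw [mul_one]
    obtain ⟨c, hc⟩ := mem_range_of_annihilated j hess (ψ x₀) fun r hr ↦ by
      rw [← map_smul, hx₀, ← map_smul]
      have : r • Ideal.Quotient.mk (maximalIdeal R) 1 = 0 :=
        Ideal.Quotient.eq_zero_iff_mem.2 (Ideal.mul_mem_right _ _ hr)
      rw [this, map_zero, map_zero]
    obtain ⟨c, rfl⟩ := Ideal.Quotient.mk_surjective c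
    refine ⟨Ideal.Quotient.mk _ c, LinearMap.ext fun x ↦ ?_⟩
    have hc' : Ideal.Quotient.mk (maximalIdeal R) c = c • Ideal.Quotient.mk _ 1 := by
      change _ = Ideal.Quotient.mk _ (c * 1)
      rw [mul_one]
    obtain ⟨r, rfl⟩ := hx x
    rw [map_smul, map_smul, hc', map_smul, LinearMap.smul_apply, h₁, ← hc, hc', map_smul, hx₀,
      e.apply_symm_apply]

lemma extPairing_bijective
    (hk : Subsingleton (ModExt R (d + 1) (R ⧸ maximalIdeal R) W))
    (L : Type u) [AddCommGroup L] [Module R L] (hL : IsFiniteLength R L)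
    (hI : I ≤ Module.annihilator R L) : Function.Bijective (extPairing d I g L hI) := by
  induction hL with
  | @of_subsingleton M _ _ _ =>
    have : Subsingleton (ModExt R d M W) := ModExt.subsingleton_of_subsingleton_left
    exact ⟨Function.injective_of_subsingleton _, fun f ↦ ⟨0, LinearMap.ext fun x ↦ by
      rw [Subsingleton.elim x 0, map_zero, map_zero]⟩⟩
  | @of_simple_quotient M _ _ N _ hN ih =>
    have hIN : I ≤ Module.annihilator R N :=
      hI.trans (LinearMap.annihilator_le_of_injective _ N.injective_subtype)
    have hIQ : I ≤ Module.annihilator R (M ⧸ N) :=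
      hI.trans (LinearMap.annihilator_le_of_surjective _ N.mkQ_surjective)
    obtain ⟨J, hJ, ⟨e'⟩⟩ := isSimpleModule_iff_quot_maximal.1 ‹IsSimpleModule R (M ⧸ N)›
    obtain rfl := IsLocalRing.eq_maximalIdeal hJ
    have hIk : I ≤ Module.annihilator R (R ⧸ maximalIdeal R) := by
      rwa [Ideal.annihilator_quotient]
    have hQ : Function.Bijective (extPairing d I g (M ⧸ N) hIQ) := by
      have hb := extPairing_residue_bijective d e j hj hess hIm g hg hIk
      constructor
      · rw [injective_iff_map_eq_zero]
        intro q hq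
        have : e' q = 0 := hb.1 (LinearMap.ext fun x ↦ by
          have := extPairing_map d I g hIQ hIk e'.toLinearMap q x
          rw [hq] at this
          rw [map_zero]
          exact this)
        exact (map_eq_zero_iff _ e'.injective).1 this
      · intro ψ
        obtain ⟨c, hc⟩ := hb.2 (ψ ∘ₗ ModExt.pre d W e'.toLinearMap)
        obtain ⟨q, rfl⟩ := e'.surjective c
        refine ⟨q, LinearMap.ext fun x ↦ ?_⟩
        obtain ⟨y, rfl⟩ := (ModExt.preEquiv d W e').surjective x
        exact (extPairing_map d I g hIQ hIk e'.toLinearMap q y).symm.trans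
          (LinearMap.congr_fun hc y)
    have hsub : Subsingleton (ModExt R (d + 1) (M ⧸ N) W) :=
      (ModExt.preEquiv _ W e').toEquiv.subsingleton_congr.1 hk
    have hsurj := ModExt.pre_surjective_of_succ (W := W) N.injective_subtype
      (LinearMap.exact_subtype_mkQ N) N.mkQ_surjective d hsub
    have hex := ModExt.exact_pre W d N.injective_subtype
      (LinearMap.exact_subtype_mkQ N) N.mkQ_surjective
    have ih := ih hIN
    constructor
    · rw [injective_iff_map_eq_zero]
      intro m hm
      have h₁ : N.mkQ m = 0 := hQ.1 (LinearMap.ext fun x ↦ by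
        rw [extPairing_map d I g hI hIQ, hm, map_zero]; rfl)
      obtain ⟨n, rfl⟩ := (LinearMap.exact_subtype_mkQ N m).1 h₁
      have h₂ : n = 0 := ih.1 (LinearMap.ext fun x ↦ by
        obtain ⟨y, rfl⟩ := hsurj x
        rw [← extPairing_map d I g hIN hI, hm, map_zero]; rfl)
      rw [h₂, map_zero]
    · intro ψ
      obtain ⟨q, hq⟩ := hQ.2 (ψ ∘ₗ ModExt.pre d W N.mkQ)
      obtain ⟨m, rfl⟩ := N.mkQ_surjective q
      obtain ⟨χ, hχ⟩ : ∃ χ : ModExt R d N W →ₗ[R] E,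
          χ ∘ₗ ModExt.pre d W N.subtype = ψ - extPairing d I g M hI m := by
        refine exists_comp_eq_of_ker_le _ hsurj _ fun x hx ↦ ?_
        obtain ⟨y, rfl⟩ := (hex x).1 hx
        rw [LinearMap.mem_ker, LinearMap.sub_apply, ← extPairing_map d I g hI hIQ, hq]
        exact sub_self _
      obtain ⟨n, rfl⟩ := ih.2 χ
      refine ⟨m + n, LinearMap.ext fun x ↦ ?_⟩
      have h₁ := LinearMap.congr_fun hχ x
      rw [LinearMap.comp_apply, ← extPairing_map d I g hIN hI, LinearMap.sub_apply] at h₁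
      rw [map_add, LinearMap.add_apply]
      rw [eq_sub_iff_add_eq'] at h₁
      exact h₁

end Matlis

section Matlis

variable {R : Type u} [CommRing R] [IsLocalRing R] {W : Type u} [AddCommGroup W]
  [Module R W] {E : Type u} [AddCommGroup E] [Module R E]

lemma isFiniteLength_quotient_annihilator {R : Type*} [CommRing R] (T : Type*) [AddCommGroup T]
    [Module R T] (hT : IsFiniteLength R T) :
    IsFiniteLength R (R ⧸ Module.annihilator R T) := by
  obtain ⟨_, _⟩ := isFiniteLength_iff_isNoetherian_isArtinian.1 hT
  obtain ⟨n, s, hs⟩ := Module.Finite.exists_fin (R := R) (M := T)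
  let f : R →ₗ[R] (Fin n → T) := LinearMap.pi fun i ↦ LinearMap.toSpanSingleton R T (s i)
  have hf : LinearMap.ker f = Module.annihilator R T := by
    refine le_antisymm (fun r hr ↦ ?_) (fun r hr ↦ ?_)
    · rw [← Submodule.annihilator_top, ← hs, Submodule.mem_annihilator_span]
      rintro ⟨_, i, rfl⟩
      exact congrFun hr i
    · exact funext fun i ↦ Module.mem_annihilator.1 hr (s i)
  refine (isFiniteLength_iff_isNoetherian_isArtinian.2 ⟨inferInstance, inferInstance⟩ :
    IsFiniteLength R (Fin n → T)).of_injective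
    (f := (LinearMap.ker f).liftQ f le_rfl ∘ₗ (Submodule.quotEquivOfEq _ _ hf.symm).toLinearMap) ?_
  rw [LinearMap.coe_comp]
  exact (LinearMap.ker_eq_bot.1 (Submodule.ker_liftQ_eq_bot _ _ _ le_rfl)).comp
    (LinearEquiv.injective _)

/-- Matlis duality for finite length modules, through Ext into a module `W` whose only nonzero
Ext from the residue field is one-dimensional in degree `d`. -/
lemma nonempty_matlis_dual_ext_equiv (d : ℕ)
    (hk : ∀ n, n ≠ d → Subsingleton (ModExt R n (R ⧸ maximalIdeal R) W))
    (e : ModExt R d (R ⧸ maximalIdeal R) W ≃ₗ[R] (R ⧸ maximalIdeal R))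
    (hE : Module.Injective R E) (j : (R ⧸ maximalIdeal R) →ₗ[R] E) (hj : Function.Injective j)
    (hess : ∀ W : Submodule R E, W ≠ ⊥ → W ⊓ LinearMap.range j ≠ ⊥)
    (T : Type u) [AddCommGroup T] [Module R T] (hT : IsFiniteLength R T) :
    Nonempty ((ModExt R d T W →ₗ[R] E) ≃ₗ[R] T) := by
  obtain hT' | hT' := subsingleton_or_nontrivial T
  · have : Subsingleton (ModExt R d T W) := ModExt.subsingleton_of_subsingleton_left
    have : Subsingleton (ModExt R d T W →ₗ[R] E) :=
      subsingleton_of_forall_eq 0 fun f ↦ LinearMap.ext fun x ↦ by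
        rw [Subsingleton.elim x 0, map_zero, map_zero]
    exact ⟨0⟩
  set I := Module.annihilator R T with hI
  have hIm : I ≤ maximalIdeal R := le_maximalIdeal fun h ↦ by
    rw [hI, Module.annihilator_eq_top_iff] at h
    exact not_subsingleton T h
  have hlen : IsFiniteLength R (R ⧸ I) := isFiniteLength_quotient_annihilator T hT
  have hsurj : Function.Surjective (Submodule.factor hIm) := Submodule.factor_surjective hIm
  have hinj : Function.Injective (ModExt.pre d W (Submodule.factor hIm)) :=
    ModExt.pre_injective_of_pred (Submodule.injective_subtype _)
      (LinearMap.exact_subtype_ker_map (Submodule.factor hIm)) hsurj d fun m hm ↦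
        ModExt.subsingleton_of_isFiniteLength m (hk m (by lia)) _
          (hlen.of_injective (Submodule.injective_subtype _))
  obtain ⟨g, hg⟩ := hE.out (ModExt.pre d W (Submodule.factor hIm)) hinj (j ∘ₗ e.toLinearMap)
  exact ⟨(LinearEquiv.ofBijective _ (extPairing_bijective d e j hj hess hIm g hg
    (hk _ (by lia)) T hT hI.le)).symm⟩

end Matlis

namespace ModExt

lemma subsingleton_of_subsingleton_right {R : Type u} [CommRing R] {X Y : Type u}
    [AddCommGroup X] [Module R X] [AddCommGroup Y] [Module R Y] {n : ℕ} [Subsingleton Y] :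
    Subsingleton (ModExt R n X Y) :=
  subsingleton_of_forall_eq 0 fun x ↦ by
    rw [← one_smul R x, ← post_smul_id, Subsingleton.elim ((1 : R) • (LinearMap.id : Y →ₗ[R] Y)) 0]
    simp [post_apply]

/-- Ext vanishing descends along a bijective algebra map. -/
lemma subsingleton_of_bijective_algebraMap {R S : Type u} [CommRing R] [CommRing S] [Algebra R S]
    (h : Function.Bijective (algebraMap R S)) (n : ℕ) (X Y : Type u)
    [AddCommGroup X] [Module R X] [Module S X] [IsScalarTower R S X]
    [AddCommGroup Y] [Module R Y] [Module S Y] [IsScalarTower R S Y]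
    (hS : Subsingleton (ModExt S n X Y)) : Subsingleton (ModExt R n X Y) := by
  let e : R ≃+* S := RingEquiv.ofBijective (algebraMap R S) h
  let F : ModuleCat.{u} S ⥤ ModuleCat.{u} R := ModuleCat.restrictScalars e.toRingHom
  have hb := F.mapExt_bijective_of_preservesProjectiveObjects (ModuleCat.of S X)
    (ModuleCat.of S Y) n
  have h₁ : Subsingleton (Abelian.Ext (F.obj (ModuleCat.of S X)) (F.obj (ModuleCat.of S Y)) n) :=
    hb.2.subsingleton
  let i (Z : Type u) [AddCommGroup Z] [Module R Z] [Module S Z] [IsScalarTower R S Z] :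
      Z ≃ₗ[R] F.obj (ModuleCat.of S Z) :=
    { AddEquiv.refl Z with
      map_smul' := fun r z ↦ (algebraMap_smul S r z).symm }
  have h₂ : Subsingleton (ModExt R n (F.obj (ModuleCat.of S X)) (F.obj (ModuleCat.of S Y))) := h₁
  have h₃ : Subsingleton (ModExt R n (F.obj (ModuleCat.of S X)) Y) :=
    (postEquiv n _ (i Y)).toEquiv.subsingleton_congr.2 h₂
  exact (preEquiv n _ (i X)).toEquiv.subsingleton_congr.1 h₃

end ModExt

/-- The residue fields agree along a bijective algebra map. -/
lemma nonempty_residue_equiv_of_bijective_algebraMap {R S : Type*} [CommRing R] [CommRing S]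
    [IsLocalRing R] [IsLocalRing S] [Algebra R S] (h : Function.Bijective (algebraMap R S)) :
    Nonempty ((R ⧸ maximalIdeal R) ≃ₗ[R] (S ⧸ maximalIdeal S)) := by
  let f : R →ₗ[R] (S ⧸ maximalIdeal S) := Algebra.linearMap R _
  have hf : Function.Surjective f := fun y ↦ by
    obtain ⟨s, rfl⟩ := Ideal.Quotient.mk_surjective y
    obtain ⟨r, rfl⟩ := h.2 s
    exact ⟨r, rfl⟩
  have hk : maximalIdeal R = LinearMap.ker f := by
    ext r
    have : f r = 0 ↔ algebraMap R S r ∈ maximalIdeal S := Ideal.Quotient.eq_zero_iff_mem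
    rw [LinearMap.mem_ker, this, mem_maximalIdeal, mem_maximalIdeal, mem_nonunits_iff,
      mem_nonunits_iff, not_iff_not]
    exact (MulEquiv.isUnit_map (RingEquiv.ofBijective (algebraMap R S) h)).symm
  exact ⟨Submodule.quotEquivOfEq _ _ hk ≪≫ₗ f.quotKerEquivOfSurjective hf⟩

section Depth

variable {R : Type} [CommRing R]

lemma nonempty_extGroup_equiv (n : ℕ) (X Y : Type) [AddCommGroup X] [Module R X] [AddCommGroup Y]
    [Module R Y] : Nonempty (extGroup R n X Y ≃ₗ[R] ModExt R n X Y) :=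
  nonempty_ext_linearEquiv _ _ n

variable [IsLocalRing R]

lemma subsingleton_modExt_of_lt_moduleDepth (X : Type) [AddCommGroup X] [Module R X] (n : ℕ)
    (h : n < moduleDepth R X) : Subsingleton (ModExt R n (R ⧸ maximalIdeal R) X) := by
  by_contra hn
  rw [not_subsingleton_iff_nontrivial] at hn
  obtain ⟨e⟩ := nonempty_extGroup_equiv (R := R) n (R ⧸ maximalIdeal R) X
  exact h.not_ge (sInf_le ⟨n, rfl, e.toEquiv.nontrivial⟩)

lemma nontrivial_modExt_of_moduleDepth_eq (X : Type) [AddCommGroup X] [Module R X] (d : ℕ)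
    (h : moduleDepth R X = d) : Nontrivial (ModExt R d (R ⧸ maximalIdeal R) X) := by
  obtain ⟨e⟩ := nonempty_extGroup_equiv (R := R) d (R ⧸ maximalIdeal R) X
  have hne : {n : ℕ∞ | ∃ k : ℕ, n = k ∧
      Nontrivial (extGroup R k (R ⧸ IsLocalRing.maximalIdeal R) X)}.Nonempty := by
    by_contra hne
    rw [Set.not_nonempty_iff_eq_empty] at hne
    rw [moduleDepth, hne, sInf_empty] at h
    exact ENat.top_ne_natCast d h
  obtain ⟨k, hk, hk'⟩ := csInf_mem hne
  have : k = d := by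
    have : (k : ℕ∞) = d := hk.symm.trans h
    exact_mod_cast this
  subst this
  exact e.symm.toEquiv.nontrivial

/-- A maximal Cohen-Macaulay module over a local ring of dimension `d` has depth at least `d`. -/
lemma IsMCM.subsingleton_modExt {N : Type} [AddCommGroup N] [Module R N] (hN : IsMCM R N)
    {d : ℕ} (hd : ringKrullDim R = d) (n : ℕ) (hn : n < d) :
    Subsingleton (ModExt R n (R ⧸ maximalIdeal R) N) := by
  obtain hN' | hN' := subsingleton_or_nontrivial N
  · exact ModExt.subsingleton_of_subsingleton_right
  let p : PrimeSpectrum R := closedPoint R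
  let S := Localization.AtPrime p.asIdeal
  have hb : Function.Bijective (algebraMap R S) := by
    refine (IsLocalization.atUnits R p.asIdeal.primeCompl (S := S) fun x hx ↦ ?_).bijective
    exact notMem_maximalIdeal.1 hx
  have : IsLocalizedModule p.asIdeal.primeCompl (LinearMap.id : N →ₗ[R] N) := by
    have : IsLocalization p.asIdeal.primeCompl R :=
      IsLocalization.self fun x hx ↦ notMem_maximalIdeal.1 hx
    exact isLocalizedModule_id p.asIdeal.primeCompl N R
  let i : LocalizedModule p.asIdeal.primeCompl N ≃ₗ[R] N :=
    IsLocalizedModule.iso p.asIdeal.primeCompl LinearMap.id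
  have hdep := hN p i.toEquiv.nontrivial
  rw [← ringKrullDim_eq_of_ringEquiv (RingEquiv.ofBijective (algebraMap R S) hb), hd] at hdep
  have hdep' : moduleDepth S (LocalizedModule p.asIdeal.primeCompl N) = d := by
    exact_mod_cast hdep
  have h₁ := subsingleton_modExt_of_lt_moduleDepth (R := S)
    (LocalizedModule p.asIdeal.primeCompl N) n (by rw [hdep']; exact_mod_cast hn)
  have h₂ := ModExt.subsingleton_of_bijective_algebraMap hb n _ _ h₁
  obtain ⟨e⟩ := nonempty_residue_equiv_of_bijective_algebraMap hb
  have h₃ := (ModExt.preEquiv n _ e).toEquiv.subsingleton_congr.1 h₂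
  exact (ModExt.postEquiv n _ i).toEquiv.subsingleton_congr.1 h₃

end Depth

section Punctured

variable {R : Type*} [CommRing R] [IsLocalRing R]

/-- For every prime `p` other than the maximal ideal, multiplication by some element outside `p`
factors through a finite free module. -/
def IsPuncturedProjective (R : Type*) [CommRing R] [IsLocalRing R] (M : Type*) [AddCommGroup M]
    [Module R M] : Prop :=
  ∀ p : PrimeSpectrum R, p.asIdeal ≠ maximalIdeal R → ∃ s ∉ p.asIdeal, ∃ (n : ℕ)
    (f : M →ₗ[R] Fin n → R) (g : (Fin n → R) →ₗ[R] M), g ∘ₗ f = s • LinearMap.id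

lemma isPuncturedProjective_of_free {M : Type*} [AddCommGroup M] [Module R M]
    [Module.FinitePresentation R M]
    (hM : ∀ p : PrimeSpectrum R, p.asIdeal ≠ maximalIdeal R →
      Module.Free (Localization.AtPrime p.asIdeal) (LocalizedModule p.asIdeal.primeCompl M)) :
    IsPuncturedProjective R M := by
  intro p hp
  have := hM p hp
  obtain ⟨n, g, hg⟩ := Module.Finite.exists_fin' R M
  let S := p.asIdeal.primeCompl
  let a := LocalizedModule.mkLinearMap S M
  let b := LocalizedModule.mkLinearMap S (Fin n → R)
  let A := Localization.AtPrime p.asIdeal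
  let g' : LocalizedModule S (Fin n → R) →ₗ[A] LocalizedModule S M :=
    IsLocalizedModule.mapExtendScalars S b a A g
  have hg' : Function.Surjective g' := IsLocalizedModule.map_surjective S b a g hg
  obtain ⟨σ, hσ⟩ := Module.projective_lifting_property g' LinearMap.id hg'
  obtain ⟨⟨f, s⟩, hf⟩ := IsLocalizedModule.surj S (IsLocalizedModule.map S a b)
    (σ.restrictScalars R)
  have key : IsLocalizedModule.map S a a (g ∘ₗ f) =
      IsLocalizedModule.map S a a (s.1 • LinearMap.id) := by
    rw [IsLocalizedModule.map_comp' S a b a, ← hf, map_smul, IsLocalizedModule.map_id]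
    refine LinearMap.ext fun x ↦ ?_
    change IsLocalizedModule.map S b a g (s.1 • σ x) = s.1 • x
    rw [map_smul]
    exact congrArg (s.1 • ·) (LinearMap.congr_fun hσ x)
  obtain ⟨c, hc⟩ := IsLocalizedModule.exists_of_eq (S := S) key
  refine ⟨c.1 * s.1, (c * s).2, n, c.1 • f, g, ?_⟩
  rw [LinearMap.comp_smul, mul_smul]
  exact hc

variable {K F M N : Type*} [AddCommGroup K] [Module R K] [AddCommGroup F] [Module R F]
  [AddCommGroup M] [Module R M] [AddCommGroup N] [Module R N]
  {ι : K →ₗ[R] F} {π : F →ₗ[R] M}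

lemma IsPuncturedProjective.exists_retraction (hM : IsPuncturedProjective R M)
    (hι : Function.Injective ι) (h : Function.Exact ι π) (hπ : Function.Surjective π)
    (p : PrimeSpectrum R) (hp : p.asIdeal ≠ maximalIdeal R) :
    ∃ s ∉ p.asIdeal, ∃ τ : F →ₗ[R] K, τ ∘ₗ ι = s • LinearMap.id := by
  obtain ⟨s, hs, n, f, g, hfg⟩ := hM p hp
  obtain ⟨g', hg'⟩ := Module.projective_lifting_property π g hπ
  let φ : F →ₗ[R] F := s • LinearMap.id - g' ∘ₗ f ∘ₗ π
  have hφ (x) : φ x ∈ LinearMap.range ι := by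
    refine (h _).1 ?_
    have h₁ := LinearMap.congr_fun hg' (f (π x))
    have h₂ := LinearMap.congr_fun hfg (π x)
    simp only [LinearMap.comp_apply, LinearMap.smul_apply, LinearMap.id_apply] at h₁ h₂
    simp [φ, h₁, h₂]
  let e := LinearEquiv.ofInjective ι hι
  refine ⟨s, hs, e.symm.toLinearMap ∘ₗ φ.codRestrict _ hφ, LinearMap.ext fun x ↦ ?_⟩
  simp only [LinearMap.comp_apply, LinearEquiv.coe_coe, LinearEquiv.symm_apply_eq]
  ext
  simp [φ, e, h.apply_apply_eq_zero]

lemma IsPuncturedProjective.syzygy (hM : IsPuncturedProjective R M) {n : ℕ}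
    {ι : K →ₗ[R] Fin n → R} {π : (Fin n → R) →ₗ[R] M}
    (hι : Function.Injective ι) (h : Function.Exact ι π) (hπ : Function.Surjective π) :
    IsPuncturedProjective R K := fun p hp ↦
  have ⟨s, hs, τ, hτ⟩ := hM.exists_retraction hι h hπ p hp
  ⟨s, hs, n, ι, τ, hτ⟩

lemma isFiniteLength_of_exists_smul_eq_zero {T : Type*} [AddCommGroup T] [Module R T]
    [IsNoetherianRing R] [Module.Finite R T]
    (h : ∀ p : PrimeSpectrum R, p.asIdeal ≠ maximalIdeal R →
      ∃ s ∉ p.asIdeal, ∀ t : T, s • t = 0) : IsFiniteLength R T := by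
  set I := Module.annihilator R T with hI
  have : Ring.KrullDimLE 0 (R ⧸ I) := .mk₀ fun J hJ ↦ by
    have hs : Function.Surjective (Ideal.Quotient.mk I) := Ideal.Quotient.mk_surjective
    have : (J.comap (Ideal.Quotient.mk I)) = maximalIdeal R := by
      by_contra hp
      obtain ⟨s, hs, hs'⟩ := h ⟨J.comap (Ideal.Quotient.mk I), inferInstance⟩ hp
      refine hs ?_
      have : Ideal.Quotient.mk I s = 0 :=
        Ideal.Quotient.eq_zero_iff_mem.2 (Module.mem_annihilator.2 hs')
      change Ideal.Quotient.mk I s ∈ J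
      rw [this]
      exact zero_mem _
    have hmax : (J.comap (Ideal.Quotient.mk I)).IsMaximal := this ▸ inferInstance
    rw [← Ideal.map_comap_of_surjective _ hs J]
    exact (Ideal.map_eq_top_or_isMaximal_of_surjective _ hs hmax).resolve_left fun htop ↦
      hJ.ne_top (by rwa [Ideal.map_comap_of_surjective _ hs J] at htop)
  have h₁ : IsArtinianRing (R ⧸ I) := isArtinianRing_iff_krullDimLE_zero.2 this
  have h₂ : IsArtinian R (R ⧸ I) :=
    isArtinian_of_surjective_algebraMap (R := R ⧸ I) (M := R ⧸ I) Ideal.Quotient.mk_surjective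
  obtain ⟨n, s, hs⟩ := Module.Finite.exists_fin (R := R) (M := T)
  let f : (Fin n → R ⧸ I) →ₗ[R] T := LinearMap.lsum R _ R fun i ↦
    I.liftQ (LinearMap.toSpanSingleton R T (s i)) fun r hr ↦ Module.mem_annihilator.1 hr (s i)
  have hf : Function.Surjective f := by
    rw [← LinearMap.range_eq_top, eq_top_iff, ← hs, Submodule.span_le]
    rintro _ ⟨i, rfl⟩
    refine ⟨Pi.single i (Ideal.Quotient.mk I 1), ?_⟩
    rw [LinearMap.lsum_piSingle]
    exact one_smul R (s i)
  exact isFiniteLength_iff_isNoetherian_isArtinian.2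
    ⟨inferInstance, isArtinian_of_surjective _ f hf⟩

lemma IsPuncturedProjective.isFiniteLength_ker_rTensor [IsNoetherianRing R] [Module.Finite R K]
    [Module.Finite R N] (hM : IsPuncturedProjective R M)
    (hι : Function.Injective ι) (h : Function.Exact ι π) (hπ : Function.Surjective π) :
    IsFiniteLength R (LinearMap.ker (ι.rTensor N)) := by
  refine isFiniteLength_of_exists_smul_eq_zero fun p hp ↦ ?_
  obtain ⟨s, hs, τ, hτ⟩ := hM.exists_retraction hι h hπ p hp
  refine ⟨s, hs, fun t ↦ Subtype.ext ?_⟩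
  have h₁ := LinearMap.congr_fun (congrArg (LinearMap.rTensor N) hτ) t.1
  rw [LinearMap.rTensor_comp, LinearMap.comp_apply, LinearMap.mem_ker.1 t.2, map_zero,
    LinearMap.rTensor_smul, LinearMap.rTensor_id] at h₁
  exact h₁.symm

end Punctured

lemma LinearMap.nonempty_equiv_of_ker_eq {R A B C : Type*} [CommRing R] [AddCommGroup A]
    [Module R A] [AddCommGroup B] [Module R B] [AddCommGroup C] [Module R C] (p : A →ₗ[R] B)
    (q : A →ₗ[R] C) (hp : Function.Surjective p) (hq : Function.Surjective q)
    (h : LinearMap.ker p = LinearMap.ker q) : Nonempty (B ≃ₗ[R] C) :=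
  ⟨(p.quotKerEquivOfSurjective hp).symm ≪≫ₗ Submodule.quotEquivOfEq _ _ h ≪≫ₗ
    q.quotKerEquivOfSurjective hq⟩

/-- Every finite module over a Noetherian ring has a finite syzygy. -/
lemma Module.Finite.exists_syzygy (R : Type u) [CommRing R] [IsNoetherianRing R] (M : Type u)
    [AddCommGroup M] [Module R M] [Module.Finite R M] :
    ∃ (n : ℕ) (K : Type u) (_ : AddCommGroup K) (_ : Module R K) (_ : Module.Finite R K)
      (ι : K →ₗ[R] Fin n → R) (π : (Fin n → R) →ₗ[R] M), Function.Injective ι ∧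
        Function.Exact ι π ∧ Function.Surjective π := by
  obtain ⟨n, π, hπ⟩ := Module.Finite.exists_fin' R M
  exact ⟨n, LinearMap.ker π, inferInstance, inferInstance, inferInstance, (LinearMap.ker π).subtype,
    π, Submodule.injective_subtype _, LinearMap.exact_subtype_ker_map π, hπ⟩

namespace ModExt

section

variable {R : Type u} [CommRing R] {K F M N W : Type u} [AddCommGroup K] [Module R K]
  [AddCommGroup F] [Module R F] [AddCommGroup M] [Module R M] [AddCommGroup N] [Module R N]
  [AddCommGroup W] [Module R W] {ι : K →ₗ[R] F} {π : F →ₗ[R] M}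

lemma pre_zeroEquiv_symm (g : K →ₗ[R] F) (f : F →ₗ[R] W) :
    pre 0 W g ((zeroEquiv F W).symm f) = (zeroEquiv K W).symm (f ∘ₗ g) :=
  Abelian.Ext.mk₀_comp_mk₀ _ _

/-- `Ext¹(M, Hom(N, W))` is the cokernel of the restriction map from `Hom(F ⊗ N, W)` to
`Hom(K ⊗ N, W)`, for a short exact sequence `0 → K → F → M → 0` with `F` projective. -/
lemma exists_surjective_ext_one [Module.Projective R F] (hι : Function.Injective ι)
    (h : Function.Exact ι π) (hπ : Function.Surjective π) :
    ∃ p : ModExt R 0 (K ⊗[R] N) W →ₗ[R] ModExt R 1 M (N →ₗ[R] W), Function.Surjective p ∧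
      LinearMap.ker p = LinearMap.range (pre 0 W (ι.rTensor N)) := by
  obtain ⟨δ, hδ₁, hδ₂⟩ := exists_pre_connecting (N →ₗ[R] W) 0 hι h hπ
  have : Subsingleton (ModExt R (0 + 1) F (N →ₗ[R] W)) := subsingleton_of_projective
  have hδ : Function.Surjective δ := hδ₂.surjective_of_subsingleton
  let e (X : Type u) [AddCommGroup X] [Module R X] :
      ModExt R 0 (X ⊗[R] N) W ≃ₗ[R] ModExt R 0 X (N →ₗ[R] W) :=
    zeroEquiv _ _ ≪≫ₗ (TensorProduct.lift.equiv (.id R) X N W).symm ≪≫ₗ (zeroEquiv _ _).symm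
  have he (x : ModExt R 0 (F ⊗[R] N) W) :
      e K (pre 0 W (ι.rTensor N) x) = pre 0 _ ι (e F x) := by
    obtain ⟨f, rfl⟩ := (zeroEquiv _ _).symm.surjective x
    rw [pre_zeroEquiv_symm]
    simp only [e, LinearEquiv.trans_apply, LinearEquiv.apply_symm_apply]
    rw [pre_zeroEquiv_symm]
    rfl
  refine ⟨δ ∘ₗ (e K).toLinearMap, hδ.comp (e K).surjective, ?_⟩
  ext x
  rw [LinearMap.mem_ker, LinearMap.comp_apply, LinearEquiv.coe_coe, hδ₁]
  constructor
  · rintro ⟨y, hy⟩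
    obtain ⟨y, rfl⟩ := (e F).surjective y
    exact ⟨y, (e K).injective (by rw [he, hy])⟩
  · rintro ⟨y, rfl⟩
    exact ⟨e F y, (he y).symm⟩

variable {A B C : Type u} [AddCommGroup A] [Module R A] [AddCommGroup B] [Module R B]
  [AddCommGroup C] [Module R C] {f : A →ₗ[R] B} {g : B →ₗ[R] C}

/-- If `W` has no first Ext from finite modules, the cokernel of restriction along `f` is
`Hom(ker f, W)`. -/
lemma exists_surjective_ext_zero_ker
    (h₁ : Subsingleton (ModExt R 1 (LinearMap.range f) W))
    (h₂ : Subsingleton (ModExt R 1 (B ⧸ LinearMap.range f) W)) :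
    ∃ q : ModExt R 0 A W →ₗ[R] ModExt R 0 (LinearMap.ker f) W, Function.Surjective q ∧
      LinearMap.ker q = LinearMap.range (pre 0 W f) := by
  have hex := LinearMap.exact_subtype_ker_map f.rangeRestrict
  have hker : LinearMap.ker f.rangeRestrict = LinearMap.ker f := f.ker_rangeRestrict
  rw [← hker]
  have hs := pre_surjective_of_succ (W := W) (Submodule.injective_subtype _)
    (LinearMap.exact_subtype_mkQ (LinearMap.range f)) (Submodule.mkQ_surjective _) 0 h₂
  refine ⟨pre 0 W (Submodule.subtype _),
    pre_surjective_of_succ (Submodule.injective_subtype _) hex f.surjective_rangeRestrict 0 h₁, ?_⟩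
  ext x
  rw [LinearMap.mem_ker, exact_pre W 0 (Submodule.injective_subtype _) hex
    f.surjective_rangeRestrict x]
  constructor
  · rintro ⟨y, rfl⟩
    obtain ⟨z, rfl⟩ := hs y
    exact ⟨z, by rw [← pre_comp_apply, LinearMap.subtype_comp_codRestrict]⟩
  · rintro ⟨z, rfl⟩
    exact ⟨pre 0 W (Submodule.subtype _) z,
      by rw [← pre_comp_apply, LinearMap.subtype_comp_codRestrict]⟩

/-- If `Hom(ker f, W) = 0` and `Ext¹(B, W) = 0`, then the cokernel of restriction along `f` is
`Ext¹(coker f, W)`. -/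
lemma exists_surjective_ext_one_coker (hfg : Function.Exact f g) (hg : Function.Surjective g)
    (h₀ : Subsingleton (ModExt R 0 (LinearMap.ker f) W))
    (h₁ : Subsingleton (ModExt R 1 B W)) :
    ∃ q : ModExt R 0 A W →ₗ[R] ModExt R 1 C W, Function.Surjective q ∧
      LinearMap.ker q = LinearMap.range (pre 0 W f) := by
  have hex := LinearMap.exact_subtype_ker_map f.rangeRestrict
  have hker : LinearMap.ker f.rangeRestrict = LinearMap.ker f := f.ker_rangeRestrict
  rw [← hker] at h₀
  let e : ModExt R 0 (LinearMap.range f) W ≃ₗ[R] ModExt R 0 A W :=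
    .ofBijective (pre 0 W f.rangeRestrict)
      ⟨pre_injective_of_surjective _ f.surjective_rangeRestrict,
      (exact_pre W 0 (Submodule.injective_subtype _) hex
        f.surjective_rangeRestrict).surjective_of_subsingleton⟩
  have hex' : Function.Exact (LinearMap.range f).subtype g := by
    rw [LinearMap.exact_iff, Submodule.range_subtype]
    exact LinearMap.exact_iff.1 hfg
  obtain ⟨δ, hδ₁, hδ₂⟩ := exists_pre_connecting W 0 (Submodule.injective_subtype _) hex' hg
  have hδ : Function.Surjective δ := by
    have : Subsingleton (ModExt R (0 + 1) B W) := h₁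
    exact hδ₂.surjective_of_subsingleton
  refine ⟨δ ∘ₗ e.symm.toLinearMap, hδ.comp e.symm.surjective, ?_⟩
  have he (z : ModExt R 0 B W) : e (pre 0 W (Submodule.subtype _) z) = pre 0 W f z := by
    change pre 0 W _ _ = _
    rw [← pre_comp_apply, LinearMap.subtype_comp_codRestrict]
  ext x
  rw [LinearMap.mem_ker, LinearMap.comp_apply, LinearEquiv.coe_coe, hδ₁]
  constructor
  · rintro ⟨y, hy⟩
    exact ⟨y, by rw [← he, hy, e.apply_symm_apply]⟩
  · rintro ⟨y, rfl⟩
    exact ⟨y, by rw [← he, e.symm_apply_apply]⟩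

/-- Dimension shifting along an exact sequence `A → B → C → 0` whose first map has a kernel with
no Ext in low degrees. -/
lemma nonempty_ext_equiv_of_exact (hfg : Function.Exact f g) (hg : Function.Surjective g) (n : ℕ)
    (h₀ : ∀ m, m < n + 2 → Subsingleton (ModExt R m (LinearMap.ker f) W))
    (h₁ : ∀ m, 0 < m → Subsingleton (ModExt R m B W)) :
    Nonempty (ModExt R (n + 1) A W ≃ₗ[R] ModExt R (n + 2) C W) := by
  rw [← LinearMap.ker_rangeRestrict] at h₀
  obtain ⟨e₃⟩ := nonempty_equiv_right (W := W) (Submodule.injective_subtype _)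
    (LinearMap.exact_subtype_ker_map f.rangeRestrict)
    f.surjective_rangeRestrict (n + 1) (fun m hm ↦ h₀ m (by lia)) (h₀ _ (by lia))
  have hex : Function.Exact (LinearMap.range f).subtype g := by
    rw [LinearMap.exact_iff, Submodule.range_subtype]
    exact LinearMap.exact_iff.1 hfg
  obtain ⟨e₄⟩ := nonempty_equiv_connecting (W := W) (Submodule.injective_subtype _) hex
    hg (n + 1) (h₁ _ (by lia)) (h₁ _ (by lia))
  exact ⟨e₃.symm ≪≫ₗ e₄⟩

end

section

variable {R : Type u} [CommRing R] [IsNoetherianRing R] [IsLocalRing R] {N W : Type u}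
  [AddCommGroup N] [Module R N] [Module.Finite R N] [AddCommGroup W] [Module R W]

omit [IsNoetherianRing R] [IsLocalRing R] [Module.Finite R N] in
lemma subsingleton_free_tensor (hN : ∀ j, 0 < j → Subsingleton (ModExt R j N W)) (n j : ℕ)
    (hj : 0 < j) : Subsingleton (ModExt R j ((Fin n → R) ⊗[R] N) W) :=
  (preEquiv j W (TensorProduct.comm R _ _ ≪≫ₗ
    TensorProduct.piScalarRight R R N (Fin n))).toEquiv.subsingleton_congr.1
      (subsingleton_pi j n (hN j hj))

variable (d : ℕ) (hN : ∀ j, 0 < j → Subsingleton (ModExt R j N W))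
  (hW : ∀ (L : Type u) [AddCommGroup L] [Module R L], IsFiniteLength R L → ∀ j, j ≠ d →
    Subsingleton (ModExt R j L W))

include hN hW

/-- Tensor-Hom adjunction for Ext below the degree `d + 1`. -/
lemma nonempty_ext_hom_equiv_ext_tensor (j : ℕ) (hj : j < d) (M : Type u) [AddCommGroup M]
    [Module R M] [Module.Finite R M] (hM : IsPuncturedProjective R M) :
    Nonempty (ModExt R (j + 1) M (N →ₗ[R] W) ≃ₗ[R] ModExt R (j + 1) (M ⊗[R] N) W) := by
  induction j generalizing M with
  | zero =>
    obtain ⟨n, K, _, _, _, ι, π, hι, h, hπ⟩ := Module.Finite.exists_syzygy R M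
    obtain ⟨p, hp, hp'⟩ := exists_surjective_ext_one (N := N) (W := W) hι h hπ
    obtain ⟨q, hq, hq'⟩ := exists_surjective_ext_one_coker (W := W) (rTensor_exact N h hπ)
      (LinearMap.rTensor_surjective N hπ)
      (hW _ (hM.isFiniteLength_ker_rTensor hι h hπ) 0 hj.ne)
      (subsingleton_free_tensor hN n 1 one_pos)
    exact LinearMap.nonempty_equiv_of_ker_eq p q hp hq (hp'.trans hq'.symm)
  | succ j ih =>
    obtain ⟨n, K, _, _, _, ι, π, hι, h, hπ⟩ := Module.Finite.exists_syzygy R M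
    have hT := hW _ (hM.isFiniteLength_ker_rTensor (N := N) hι h hπ)
    obtain ⟨e₁⟩ := nonempty_equiv_connecting (W := N →ₗ[R] W) hι h hπ (j + 1)
      subsingleton_of_projective subsingleton_of_projective
    obtain ⟨e₂⟩ := ih (by lia) K (hM.syzygy hι h hπ)
    obtain ⟨e₃⟩ := nonempty_ext_equiv_of_exact (rTensor_exact N h hπ)
      (LinearMap.rTensor_surjective N hπ) j (fun m hm ↦ hT m (by lia))
      (fun m hm ↦ subsingleton_free_tensor hN n _ hm)
    exact ⟨e₁.symm ≪≫ₗ e₂ ≪≫ₗ e₃⟩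

/-- The first Ext module above the dimension is dual to the kernel of the syzygy map after
tensoring. -/
lemma nonempty_ext_hom_equiv_ext_ker
    (hd : ∀ (X : Type u) [AddCommGroup X] [Module R X] [Module.Finite R X] (j : ℕ), d < j →
      Subsingleton (ModExt R j X W)) {K M : Type u} [AddCommGroup K] [Module R K]
    [Module.Finite R K] [AddCommGroup M] [Module R M] [Module.Finite R M]
    (hM : IsPuncturedProjective R M) {n : ℕ} {ι : K →ₗ[R] Fin n → R} {π : (Fin n → R) →ₗ[R] M}
    (hι : Function.Injective ι) (h : Function.Exact ι π) (hπ : Function.Surjective π) :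
    Nonempty (ModExt R (d + 1) M (N →ₗ[R] W) ≃ₗ[R]
      ModExt R d (LinearMap.ker (ι.rTensor N)) W) := by
  obtain _ | d := d
  · obtain ⟨p, hp, hp'⟩ := exists_surjective_ext_one (N := N) (W := W) hι h hπ
    obtain ⟨q, hq, hq'⟩ := exists_surjective_ext_zero_ker (f := ι.rTensor N) (W := W)
      (hd _ 1 one_pos) (hd _ 1 one_pos)
    exact LinearMap.nonempty_equiv_of_ker_eq p q hp hq (hp'.trans hq'.symm)
  · obtain ⟨e₁⟩ := nonempty_equiv_connecting (W := N →ₗ[R] W) hι h hπ (d + 1)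
      subsingleton_of_projective subsingleton_of_projective
    obtain ⟨e₂⟩ := nonempty_ext_hom_equiv_ext_tensor (d + 1) hN hW d (by lia) K
      (hM.syzygy hι h hπ)
    have hex : Function.Exact (LinearMap.range (ι.rTensor N)).subtype (π.rTensor N) := by
      rw [LinearMap.exact_iff, Submodule.range_subtype]
      exact LinearMap.exact_iff.1 (rTensor_exact N h hπ)
    have hB := subsingleton_left (W := W) (Submodule.injective_subtype _) hex
      (LinearMap.rTensor_surjective N hπ) (d + 1) (subsingleton_free_tensor hN n _ (by lia))
      (hd _ _ (by lia))
    obtain ⟨e₃⟩ := nonempty_equiv_left (W := W) (Submodule.injective_subtype _)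
      (LinearMap.exact_subtype_ker_map (ι.rTensor N).rangeRestrict)
      (ι.rTensor N).surjective_rangeRestrict (d + 1) hB (hd _ _ (by lia))
    rw [LinearMap.ker_rangeRestrict] at e₃
    exact ⟨e₁.symm ≪≫ₗ e₂ ≪≫ₗ e₃⟩

end

end ModExt

section Tor

open MonoidalCategory Limits

namespace CategoryTheory.ProjectiveResolution

variable {C D : Type*} [Category* C] [Abelian C] [Category* D] [Abelian D] {X : C}
  (P : ProjectiveResolution X) (F G : C ⥤ D) [F.Additive] [G.Additive]

lemma fromLeftDerivedZero'_naturality_functor (τ : F ⟶ G) :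
    HomologicalComplex.opcyclesMap ((NatTrans.mapHomologicalComplex τ _).app P.complex) 0 ≫
      P.fromLeftDerivedZero' G = P.fromLeftDerivedZero' F ≫ τ.app X := by
  simp only [← cancel_epi (HomologicalComplex.pOpcycles _ _),
    HomologicalComplex.p_opcyclesMap_assoc,
    pOpcycles_comp_fromLeftDerivedZero',
    pOpcycles_comp_fromLeftDerivedZero'_assoc]
  simp
  exact (τ.naturality (P.π.f 0)).symm

/-- The homology in degree zero of a right exact functor applied to a projective resolution. -/
noncomputable def homologyZeroIso [PreservesFiniteColimits F] :
    ((F.mapHomologicalComplex _).obj P.complex).homology 0 ≅ F.obj X :=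
  ChainComplex.isoHomologyι₀ _ ≪≫ asIso (P.fromLeftDerivedZero' F)

lemma homologyZeroIso_naturality [PreservesFiniteColimits F] [PreservesFiniteColimits G]
    (τ : F ⟶ G) :
    HomologicalComplex.homologyMap ((NatTrans.mapHomologicalComplex τ _).app P.complex) 0 ≫
        (P.homologyZeroIso G).hom = (P.homologyZeroIso F).hom ≫ τ.app X := by
  simp [homologyZeroIso, ← fromLeftDerivedZero'_naturality_functor]

end CategoryTheory.ProjectiveResolution

variable {R : Type u} [CommRing R]

/-- Tensoring a chain complex on the left with a module, as a functor of the module. -/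
noncomputable def tensorComplex (P : ChainComplex (ModuleCat.{u} R) ℕ) :
    ModuleCat.{u} R ⥤ ChainComplex (ModuleCat.{u} R) ℕ where
  obj X := (((tensoringLeft (ModuleCat.{u} R)).obj X).mapHomologicalComplex _).obj P
  map f := (NatTrans.mapHomologicalComplex ((tensoringLeft (ModuleCat.{u} R)).map f) _).app P
  map_id X := by ext i : 1; simp
  map_comp f g := by ext i : 1; simp

instance (P : ChainComplex (ModuleCat.{u} R) ℕ) : (tensorComplex P).PreservesZeroMorphisms where
  map_zero X Y := by ext i : 1; simp [tensorComplex]; rfl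

lemma tensorComplex_shortExact {N : ModuleCat.{u} R} (P : ProjectiveResolution N)
    {S : ShortComplex (ModuleCat.{u} R)} (hS : S.ShortExact) :
    (S.map (tensorComplex P.complex)).ShortExact := by
  refine HomologicalComplex.shortExact_of_degreewise_shortExact _ fun i ↦ ?_
  have : Module.Projective R (P.complex.X i) :=
    (IsProjective.iff_projective (P.complex.X i)).2 (P.projective i)
  have hf := (ModuleCat.mono_iff_injective _).1 hS.mono_f
  have hg := (ModuleCat.epi_iff_surjective _).1 hS.epi_g
  have hex := Module.Flat.rTensor_shortComplex_exact (P.complex.X i) S hS.exact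
  refine ShortComplex.ShortExact.mk' hex ?_ ?_
  · rw [ModuleCat.mono_iff_injective]
    exact Module.Flat.rTensor_preserves_injective_linearMap (M := P.complex.X i) S.f.hom hf
  · rw [ModuleCat.epi_iff_surjective]
    exact LinearMap.rTensor_surjective (P.complex.X i) hg

lemma tensorComplex_isZero_homology {N : ModuleCat.{u} R} (P : ProjectiveResolution N)
    (F : ModuleCat.{u} R) [Module.Flat R F] (n : ℕ) :
    IsZero (((tensorComplex P.complex).obj F).homology (n + 1)) := by
  have : PreservesFiniteLimits (tensorLeft F) :=
    (Module.Flat.iff_preservesFiniteLimits_tensorLeft F).1 inferInstance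
  rw [← HomologicalComplex.exactAt_iff_isZero_homology]
  exact (P.complex_exactAt_succ n).map (tensorLeft F)

instance preservesFiniteColimits_tensoringLeft (X : ModuleCat.{u} R) :
    PreservesFiniteColimits ((tensoringLeft (ModuleCat.{u} R)).obj X) :=
  inferInstanceAs (PreservesFiniteColimits (tensorLeft X))

section LinearMap

variable {K F M : Type u} [AddCommGroup K] [Module R K] [AddCommGroup F] [Module R F]
  [AddCommGroup M] [Module R M] [Module.Flat R F] {ι : K →ₗ[R] F} {π : F →ₗ[R] M}
  (hι : Function.Injective ι) (h : Function.Exact ι π) (hπ : Function.Surjective π)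
  (N : Type u) [AddCommGroup N] [Module R N]

include hι h hπ

/-- Dimension shifting for Tor in its first variable. -/
lemma nonempty_tor_equiv_syzygy (n : ℕ) :
    Nonempty (((Tor (ModuleCat.{u} R) (n + 2)).obj (ModuleCat.of R M)).obj (ModuleCat.of R N) ≃ₗ[R]
      ((Tor (ModuleCat.{u} R) (n + 1)).obj (ModuleCat.of R K)).obj (ModuleCat.of R N)) := by
  let P := projectiveResolution (ModuleCat.of R N)
  have hS := tensorComplex_shortExact P (ModExt.shortExact hι h hπ)
  let δ := hS.δIso (n + 2) (n + 1) rfl (tensorComplex_isZero_homology P (ModuleCat.of R F) (n + 1))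
    (tensorComplex_isZero_homology P (ModuleCat.of R F) n)
  exact ⟨(P.isoLeftDerivedObj ((tensoringLeft _).obj (ModuleCat.of R M)) (n + 2) ≪≫ δ ≪≫
    (P.isoLeftDerivedObj ((tensoringLeft _).obj (ModuleCat.of R K)) (n + 1)).symm).toLinearEquiv⟩

/-- The first Tor module is the kernel of the syzygy inclusion after tensoring. -/
lemma nonempty_tor_one_equiv_ker :
    Nonempty (((Tor (ModuleCat.{u} R) 1).obj (ModuleCat.of R M)).obj (ModuleCat.of R N) ≃ₗ[R]
      LinearMap.ker (ι.rTensor N)) := by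
  let P := projectiveResolution (ModuleCat.of R N)
  have hS := tensorComplex_shortExact P (ModExt.shortExact hι h hπ)
  have hm := (ModuleCat.mono_iff_injective _).1
    (hS.mono_δ 1 0 rfl (tensorComplex_isZero_homology P (ModuleCat.of R F) 0))
  have hex := (ShortComplex.ShortExact.moduleCat_exact_iff_function_exact _).1
    (hS.homology_exact₁ 1 0 rfl)
  let e (X : ModuleCat.{u} R) : ((tensorComplex P.complex).obj X).homology 0 ≅
      ((tensoringLeft (ModuleCat.{u} R)).obj X).obj (ModuleCat.of R N) :=
    P.homologyZeroIso ((tensoringLeft (ModuleCat.{u} R)).obj X)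
  let u : ((tensorComplex P.complex).obj (ModuleCat.of R M)).homology 1 →ₗ[R] K ⊗[R] N :=
    (e (ModuleCat.of R K)).toLinearEquiv.toLinearMap ∘ₗ (hS.δ 1 0 rfl).hom
  have hu : Function.Injective u := (e (ModuleCat.of R K)).toLinearEquiv.injective.comp hm
  have hnat (x : ((tensorComplex P.complex).obj (ModuleCat.of R K)).homology 0) :
      (e (ModuleCat.of R F)).toLinearEquiv
        ((HomologicalComplex.homologyMap
          ((tensorComplex P.complex).map (ModuleCat.ofHom ι)) 0).hom x) =
      ι.rTensor N ((e (ModuleCat.of R K)).toLinearEquiv x) :=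
    ConcreteCategory.congr_hom (P.homologyZeroIso_naturality _ _
      ((tensoringLeft (ModuleCat.{u} R)).map (ModuleCat.ofHom ι))) x
  have hr : LinearMap.range u = LinearMap.ker (ι.rTensor N) := by
    ext y
    obtain ⟨x, rfl⟩ := (e (ModuleCat.of R K)).toLinearEquiv.surjective y
    refine Iff.trans ?_ ((hex x).symm.trans ?_)
    · exact ⟨fun ⟨z, hz⟩ ↦ ⟨z, (e (ModuleCat.of R K)).toLinearEquiv.injective hz⟩,
        fun ⟨z, hz⟩ ↦ ⟨z, congrArg (e (ModuleCat.of R K)).toLinearEquiv hz⟩⟩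
    · rw [LinearMap.mem_ker, ← hnat, LinearEquiv.map_eq_zero_iff]
      rfl
  exact ⟨(P.isoLeftDerivedObj ((tensoringLeft _).obj (ModuleCat.of R M)) 1).toLinearEquiv ≪≫ₗ
    LinearEquiv.ofInjective u hu ≪≫ₗ LinearEquiv.ofEq _ _ hr⟩

end LinearMap

end Tor

/-- The duality between Ext and Tor over a module `W` with the homological properties of a
canonical module. -/
lemma nonempty_matlis_dual_ext_hom_equiv_tor {R : Type u} [CommRing R] [IsNoetherianRing R]
    [IsLocalRing R] {N W E : Type u} [AddCommGroup N] [Module R N] [Module.Finite R N]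
    [AddCommGroup W] [Module R W] [AddCommGroup E] [Module R E] (d : ℕ)
    (hN : ∀ j, 0 < j → Subsingleton (ModExt R j N W))
    (hk : ∀ n, n ≠ d → Subsingleton (ModExt R n (R ⧸ maximalIdeal R) W))
    (hd : ∀ (X : Type u) [AddCommGroup X] [Module R X] [Module.Finite R X] (j : ℕ),
      d < j → Subsingleton (ModExt R j X W))
    (e : ModExt R d (R ⧸ maximalIdeal R) W ≃ₗ[R] (R ⧸ maximalIdeal R))
    (hE : Module.Injective R E) (j : (R ⧸ maximalIdeal R) →ₗ[R] E) (hj : Function.Injective j)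
    (hess : ∀ W : Submodule R E, W ≠ ⊥ → W ⊓ LinearMap.range j ≠ ⊥)
    (i : ℕ) (M : Type u) [AddCommGroup M] [Module R M] [Module.Finite R M]
    (hM : IsPuncturedProjective R M) :
    Nonempty ((ModExt R (d + (i + 1)) M (N →ₗ[R] W) →ₗ[R] E) ≃ₗ[R]
      ((Tor (ModuleCat.{u} R) (i + 1)).obj (ModuleCat.of R M)).obj (ModuleCat.of R N)) := by
  induction i generalizing M with
  | zero =>
    obtain ⟨n, K, _, _, _, ι, π, hι, h, hπ⟩ := Module.Finite.exists_syzygy R M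
    obtain ⟨e₁⟩ := ModExt.nonempty_ext_hom_equiv_ext_ker (N := N) d hN
      (fun L _ _ hL n hn ↦ ModExt.subsingleton_of_isFiniteLength n (hk n hn) L hL) hd hM hι h hπ
    obtain ⟨e₂⟩ := nonempty_matlis_dual_ext_equiv d hk e hE j hj hess _
      (hM.isFiniteLength_ker_rTensor (N := N) hι h hπ)
    obtain ⟨e₃⟩ := nonempty_tor_one_equiv_ker hι h hπ N
    exact ⟨e₁.arrowCongr (LinearEquiv.refl R E) ≪≫ₗ e₂ ≪≫ₗ e₃.symm⟩
  | succ i ih =>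
    obtain ⟨n, K, _, _, _, ι, π, hι, h, hπ⟩ := Module.Finite.exists_syzygy R M
    obtain ⟨e₁⟩ := ModExt.nonempty_equiv_connecting (W := N →ₗ[R] W) hι h hπ (d + (i + 1))
      ModExt.subsingleton_of_projective ModExt.subsingleton_of_projective
    obtain ⟨e₂⟩ := ih K (hM.syzygy hι h hπ)
    obtain ⟨e₃⟩ := nonempty_tor_equiv_syzygy hι h hπ N i
    exact ⟨e₁.symm.arrowCongr (LinearEquiv.refl R E) ≪≫ₗ e₂ ≪≫ₗ e₃.symm⟩

/-- For `M` locally free on the punctured spectrum and `N` MCM, the Matlis dual of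
`Ext^{d+i}(M, Hom(N,ω))` is isomorphic to `Tor_i(M, N)` for all `i > 0`. -/
theorem matlis_dual_ext_iso_tor (R : Type) [CommRing R] [IsNoetherianRing R]
    [IsLocalRing R] (d : ℕ) (hd : ringKrullDim R = d) (hCM : IsCMLocal R)
    (ω : Type) [AddCommGroup ω] [Module R ω] (hω : IsCanonicalModule R ω)
    (M N : Type) [AddCommGroup M] [Module R M] [Module.Finite R M]
    [AddCommGroup N] [Module R N] [Module.Finite R N]
    (hloc : ∀ p : PrimeSpectrum R, p.asIdeal ≠ IsLocalRing.maximalIdeal R →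
      Module.Free (Localization.AtPrime p.asIdeal) (LocalizedModule p.asIdeal.primeCompl M))
    (hN : IsMCM R N)
    (E : Type) [AddCommGroup E] [Module R E] (hE : Module.Injective R E)
    (j : (R ⧸ IsLocalRing.maximalIdeal R) →ₗ[R] E) (hj : Function.Injective j)
    (hess : ∀ W : Submodule R E, W ≠ ⊥ → W ⊓ LinearMap.range j ≠ ⊥)
    (i : ℕ) (hi : 0 < i) :
    Nonempty ((extGroup R (d + i) M (N →ₗ[R] ω) →ₗ[R] E) ≃ₗ[R] torGroup R i M N) := by
  obtain ⟨hfin, hωMCM, ⟨s, hs⟩, d', hd', ⟨e⟩⟩ := hω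
  obtain rfl : d = d' := by exact_mod_cast hd.symm.trans hd'
  obtain ⟨i, rfl⟩ := Nat.exists_eq_add_of_lt hi
  rw [zero_add]
  have hR : Nontrivial (ModExt R d (R ⧸ maximalIdeal R) R) :=
    nontrivial_modExt_of_moduleDepth_eq R d (by
      have := Eq.trans hCM hd
      exact_mod_cast this)
  have hvanish : ∀ (X : Type) [AddCommGroup X] [Module R X] [Module.Finite R X] (j : ℕ),
      d < j → Subsingleton (ModExt R j X ω) :=
    ModExt.subsingleton_of_lt_depth d s hR
      fun X _ _ _ j hj ↦ ModExt.subsingleton_of_hasInjDimLE s ω hs X j hj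
  obtain ⟨e'⟩ := nonempty_extGroup_equiv (R := R) d (R ⧸ maximalIdeal R) ω
  obtain ⟨e₁⟩ := nonempty_extGroup_equiv (R := R) (d + (i + 1)) M (N →ₗ[R] ω)
  have : Module.FinitePresentation R M := Module.finitePresentation_of_finite R M
  obtain ⟨e₂⟩ := nonempty_matlis_dual_ext_hom_equiv_tor (N := N) (W := ω) (E := E) d
    (fun n hn ↦ ModExt.subsingleton_of_depth d hvanish d N (hN.subsingleton_modExt hd) n
      (by lia))
    (fun n hn ↦ hn.lt_or_gt.elim (hωMCM.subsingleton_modExt hd n) (hvanish _ n))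
    hvanish (e'.symm ≪≫ₗ e) hE j hj hess i M (isPuncturedProjective_of_free hloc)
  exact ⟨e₁.arrowCongr (LinearEquiv.refl R E) ≪≫ₗ e₂⟩
end

section
/- Let R be a Noetherian local ring and M, N finitely generated R-modules with M of finite projective dimension and N ≠ 0. Then sup{i ∈ ℕ : Ext^i_R(M, N) ≠ 0} = pd_R M = depth R − depth_R M. -/
open CategoryTheory TensorProduct IsLocalRing

/-- The derived-functor `Ext` and the derived-category `Ext` vanish simultaneously. -/
theorem subsingleton_extGroup_iff (R : Type) [CommRing R] (n : ℕ) (M N : Type) [AddCommGroup M]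
    [Module R M] [AddCommGroup N] [Module R N] :
    Subsingleton (extGroup R n M N) ↔
      Subsingleton (Abelian.Ext (ModuleCat.of R M) (ModuleCat.of R N) n) := by
  let P := projectiveResolution (ModuleCat.of R M)
  have key : Subsingleton (extGroup R n M N) ↔
      ∀ f : P.complex.X n ⟶ ModuleCat.of R N, P.complex.d (n + 1) n ≫ f = 0 →
        ∃ g : P.complex.X ((ComplexShape.up ℕ).prev n) ⟶ ModuleCat.of R N,
          P.complex.d n ((ComplexShape.up ℕ).prev n) ≫ g = f := by
    rw [← ModuleCat.isZero_iff_subsingleton, (P.isoExt (R := R) n (ModuleCat.of R N)).isZero_iff,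
      ← HomologicalComplex.exactAt_iff_isZero_homology,
      HomologicalComplex.exactAt_iff' _ ((ComplexShape.up ℕ).prev n) n (n + 1) rfl (by simp),
      ShortComplex.moduleCat_exact_iff]
    rfl
  rw [key]
  cases n with
  | zero =>
    have hd : P.complex.d 0 ((ComplexShape.up ℕ).prev 0) = 0 :=
      P.complex.shape _ _ (by simp)
    simp only [hd, Limits.zero_comp]
    rw [Abelian.Ext.homEquiv₀.subsingleton_congr]
    let π : P.complex.X 0 ⟶ ModuleCat.of R M := P.π.f 0
    have hπ : P.complex.d 1 0 ≫ π = 0 := P.complex_d_comp_π_f_zero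
    have hcolim : Limits.IsColimit (Limits.CokernelCofork.ofπ π hπ) := P.isColimitCokernelCofork
    constructor
    · intro h
      refine subsingleton_of_forall_eq 0 fun f ↦ ?_
      obtain ⟨-, h⟩ := h (π ≫ f) (by rw [← Category.assoc]; simp [hπ])
      have : Epi π := Limits.epi_of_isColimit_cofork hcolim
      rw [← cancel_epi π, ← h, Limits.comp_zero]
    · intro _ f hf
      obtain ⟨g, hg⟩ := Limits.CokernelCofork.IsColimit.desc' hcolim f hf
      refine ⟨0, ?_⟩
      rw [← hg, show g = 0 from Subsingleton.elim (α := ModuleCat.of R M ⟶ ModuleCat.of R N) g 0,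
        Limits.comp_zero]
  | succ n =>
    have hp : (ComplexShape.up ℕ).prev (n + 1) = n := by simp
    rw [hp]
    constructor
    · intro h
      refine subsingleton_of_forall_eq 0 fun x ↦ ?_
      obtain ⟨f, hf, rfl⟩ := P.extMk_surjective x (n + 2) rfl
      exact (P.extMk_eq_zero_iff f _ rfl hf n rfl).2 (h f hf)
    · intro _ f hf
      exact (P.extMk_eq_zero_iff f _ rfl hf n rfl).1 (Subsingleton.elim _ _)

theorem exists_surjective_linearMap_residue (R : Type) [CommRing R] [IsLocalRing R] (N : Type)
    [AddCommGroup N] [Module R N] [Module.Finite R N] [Nontrivial N] :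
    ∃ f : N →ₗ[R] R ⧸ maximalIdeal R, Function.Surjective f := by
  obtain ⟨S, hS, -⟩ := (eq_top_or_exists_le_coatom (⊥ : Submodule R N)).resolve_left bot_ne_top
  have : IsSimpleModule R (N ⧸ S) := isSimpleModule_iff_isCoatom.2 hS
  obtain ⟨I, hI, ⟨e⟩⟩ := isSimpleModule_iff_quot_maximal.1 this
  obtain rfl := IsLocalRing.eq_maximalIdeal hI
  exact ⟨e.toLinearMap ∘ₗ S.mkQ, e.surjective.comp S.mkQ_surjective⟩

/-- A finite module over a local ring has a minimal free cover. -/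
theorem exists_minimal_cover (R : Type) [CommRing R] [IsLocalRing R] (M : Type)
    [AddCommGroup M] [Module R M] [Module.Finite R M] :
    ∃ (n : ℕ) (f : (Fin n → R) →ₗ[R] M), Function.Surjective f ∧
      LinearMap.ker f ≤ maximalIdeal R • (⊤ : Submodule R (Fin n → R)) := by
  let b := Module.finBasis (ResidueField R) (ResidueField R ⊗[R] M)
  have hsurj : Function.Surjective (TensorProduct.mk R (ResidueField R) M 1) :=
    TensorProduct.mk_surjective R M (ResidueField R) residue_surjective
  choose v hv using fun i ↦ hsurj (b i)
  refine ⟨_, Fintype.linearCombination R v, ?_, ?_⟩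
  · rw [← LinearMap.range_eq_top, Fintype.range_linearCombination]
    exact IsLocalRing.span_eq_top_of_tmul_eq_basis v b hv
  · intro x hx
    rw [LinearMap.mem_ker, Fintype.linearCombination_apply] at hx
    have hx' : ∑ i, residue R (x i) • b i = 0 := by
      rw [← map_zero (TensorProduct.mk R (ResidueField R) M 1), ← hx, map_sum]
      refine Finset.sum_congr rfl fun i _ ↦ ?_
      rw [map_smul, hv]
      rfl
    have hmem : ∀ i, x i ∈ maximalIdeal R := fun i ↦
      (residue_eq_zero_iff _).1 (Fintype.linearIndependent_iff.1 b.linearIndependent _ hx' i)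
    rw [pi_eq_sum_univ' x]
    exact Submodule.sum_mem _ fun i _ ↦ Submodule.smul_mem_smul (hmem i) trivial

/-- A map out of a finite free module with image in `I • F` is an `I`-combination of maps. -/
theorem LinearMap.mem_smul_top_of_range_le {R : Type} [CommRing R] (I : Ideal R) {K F : Type}
    [AddCommGroup K] [Module R K] [Module.Free R K] [Module.Finite R K]
    [AddCommGroup F] [Module R F] (f : K →ₗ[R] F)
    (hf : LinearMap.range f ≤ I • (⊤ : Submodule R F)) :
    f ∈ I • (⊤ : Submodule R (K →ₗ[R] F)) := by
  let b := Module.Free.chooseBasis R K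
  have hsum : f = ∑ j, (b.coord j).smulRight (f (b j)) := by
    refine b.ext fun i ↦ ?_
    classical
    simp [Finsupp.single_apply, ite_smul]
  rw [hsum]
  refine Submodule.sum_mem _ fun j _ ↦ ?_
  refine Submodule.smul_induction_on
    (p := fun y ↦ (b.coord j).smulRight y ∈ I • (⊤ : Submodule R (K →ₗ[R] F)))
    (hf ⟨b j, rfl⟩) (fun r hr y _ ↦ ?_) (fun x y hx hy ↦ ?_)
  · have : (b.coord j).smulRight (r • y) = r • (b.coord j).smulRight y := by
      ext; exact smul_comm _ _ _
    rw [this]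
    exact Submodule.smul_mem_smul hr trivial
  · have : (b.coord j).smulRight (x + y) = (b.coord j).smulRight x + (b.coord j).smulRight y := by
      ext; simp
    rw [this]
    exact add_mem hx hy

section ModuleExt

variable {R : Type} [CommRing R]

theorem ext_comp_eq_zero_of_mem_smul_top {I : Ideal R} {X : ModuleCat.{0} R}
    (hI : I ≤ Module.annihilator R X) {K F : ModuleCat.{0} R} {f : K →ₗ[R] F}
    (hf : f ∈ I • (⊤ : Submodule R (K →ₗ[R] F))) {n : ℕ} (x : Abelian.Ext X K n) :
    x.comp (Abelian.Ext.mk₀ (ModuleCat.ofHom f)) (add_zero n) = 0 := by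
  refine Submodule.smul_induction_on
    (p := fun f ↦ x.comp (Abelian.Ext.mk₀ (ModuleCat.ofHom f)) (add_zero n) = 0)
    hf (fun r hr g _ ↦ ?_) (fun f g hf hg ↦ ?_)
  · have hr0 : r • 𝟙 X = 0 := by
      ext y
      exact Module.mem_annihilator.1 (hI hr) y
    have hx : r • x = 0 := by
      have : r • x = (Abelian.Ext.mk₀ (r • 𝟙 X)).comp x (zero_add n) := by
        simp [Abelian.Ext.mk₀_smul]
      rw [this, hr0]
      simp
    have : ModuleCat.ofHom (r • g) = r • ModuleCat.ofHom g := rfl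
    rw [this, Abelian.Ext.mk₀_smul, Abelian.Ext.comp_smul, ← Abelian.Ext.smul_comp, hx,
      Abelian.Ext.zero_comp]
  · have : ModuleCat.ofHom (f + g) = ModuleCat.ofHom f + ModuleCat.ofHom g := rfl
    rw [this, Abelian.Ext.mk₀_add, Abelian.Ext.comp_add, hf, hg, add_zero]

theorem ext_comp_shortComplexKer_f_eq_zero {I : Ideal R} {X : ModuleCat.{0} R}
    (hI : I ≤ Module.annihilator R X) {E M : Type} [AddCommGroup E] [Module R E]
    [AddCommGroup M] [Module R M] (f : E →ₗ[R] M) [Module.Free R (LinearMap.ker f)]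
    [Module.Finite R (LinearMap.ker f)] (hf : LinearMap.ker f ≤ I • (⊤ : Submodule R E)) {n : ℕ}
    (x : Abelian.Ext X f.shortComplexKer.X₁ n) :
    x.comp (Abelian.Ext.mk₀ f.shortComplexKer.f) (add_zero n) = 0 := by
  have hmem : (LinearMap.ker f).subtype ∈ I • (⊤ : Submodule R (LinearMap.ker f →ₗ[R] E)) :=
    LinearMap.mem_smul_top_of_range_le I _ (by rwa [Submodule.range_subtype])
  exact ext_comp_eq_zero_of_mem_smul_top (K := ModuleCat.of R (LinearMap.ker f))
    (F := ModuleCat.of R E) hI hmem x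

theorem subsingleton_ext_of_free {X : ModuleCat.{0} R} {n : ℕ}
    (h : Subsingleton (Abelian.Ext X (ModuleCat.of R R) n)) (F : Type) [AddCommGroup F]
    [Module R F] [Module.Free R F] [Module.Finite R F] :
    Subsingleton (Abelian.Ext X (ModuleCat.of R F) n) := by
  let b := Module.Free.chooseBasis R F
  have hid : 𝟙 (ModuleCat.of R F) = ∑ j, ModuleCat.ofHom (b.coord j) ≫
      ModuleCat.ofHom (LinearMap.toSpanSingleton R F (b j)) := by
    ext x
    simp [ModuleCat.hom_sum]
  refine subsingleton_of_forall_eq 0 fun x ↦ ?_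
  rw [← x.comp_mk₀_id, hid]
  rw [Abelian.Ext.mk₀_sum, Abelian.Ext.comp_sum]
  refine Finset.sum_eq_zero fun j _ ↦ ?_
  rw [← Abelian.Ext.mk₀_comp_mk₀, ← Abelian.Ext.comp_assoc_of_second_deg_zero,
    Subsingleton.elim (x.comp _ _) 0, Abelian.Ext.zero_comp]

theorem nontrivial_ext_of_free {X : ModuleCat.{0} R} {n : ℕ}
    (h : Nontrivial (Abelian.Ext X (ModuleCat.of R R) n)) (F : Type) [AddCommGroup F]
    [Module R F] [Module.Free R F] [Nontrivial F] :
    Nontrivial (Abelian.Ext X (ModuleCat.of R F) n) := by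
  let b := Module.Free.chooseBasis R F
  obtain ⟨j⟩ := b.index_nonempty
  let i := ModuleCat.ofHom (LinearMap.toSpanSingleton R F (b j))
  let p := ModuleCat.ofHom (b.coord j)
  have hip : i ≫ p = 𝟙 (ModuleCat.of R R) := by
    ext
    simp [i, p]
  have hinj : Function.Injective fun x : Abelian.Ext X (ModuleCat.of R R) n ↦
      x.comp (Abelian.Ext.mk₀ i) (add_zero n) := by
    refine Function.LeftInverse.injective
      (g := fun y ↦ y.comp (Abelian.Ext.mk₀ p) (add_zero n)) fun x ↦ ?_
    simp [Abelian.Ext.comp_assoc_of_second_deg_zero, hip]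
  exact hinj.nontrivial

theorem hasProjectiveDimensionLT_iff_hasPdLE (n : ℕ) (M : Type) [AddCommGroup M] [Module R M] :
    HasProjectiveDimensionLT (ModuleCat.of R M) (n + 1) ↔ hasPdLE R n M := by
  induction n generalizing M with
  | zero =>
    rw [zero_add, ← projective_iff_hasProjectiveDimensionLT_one,
      ← IsProjective.iff_projective]
    rfl
  | succ n ih =>
    constructor
    · intro h
      refine ⟨M →₀ R, inferInstance, inferInstance, Finsupp.linearCombination R id,
        inferInstance, Finsupp.linearCombination_id_surjective R M, ?_⟩
      have hS := LinearMap.shortExact_shortComplexKer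
        (Finsupp.linearCombination_id_surjective R M)
      have hP : Projective (ModuleCat.of R (M →₀ R)) :=
        (IsProjective.iff_projective (M →₀ R)).1 inferInstance
      exact (ih _).1 ((hS.hasProjectiveDimensionLT_X₃_iff n hP).1 h)
    · rintro ⟨P, _, _, f, hP, hf, hK⟩
      have hS := LinearMap.shortExact_shortComplexKer hf
      exact (hS.hasProjectiveDimensionLT_X₃_iff n ((IsProjective.iff_projective P).1 hP)).2
        ((ih _).2 hK)

theorem nontrivial_of_not_hasProjectiveDimensionLT_zero (M : Type) [AddCommGroup M] [Module R M]
    (h : ¬ HasProjectiveDimensionLT (ModuleCat.of R M) 0) : Nontrivial M := by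
  rwa [hasProjectiveDimensionLT_zero_iff_isZero, ModuleCat.isZero_iff_subsingleton,
    not_subsingleton_iff_nontrivial] at h

/-- Dimension shifting for the lowest nonvanishing covariant Ext. -/
theorem exists_least_ext_of_shortExact {X : ModuleCat.{0} R} {S : ShortComplex (ModuleCat.{0} R)}
    (hS : S.ShortExact) {s t : ℕ} (hst : s ≤ t)
    (hF : ∀ i < t, Subsingleton (Abelian.Ext X S.X₂ i))
    (hs0 : ∀ i < s, Subsingleton (Abelian.Ext X S.X₁ i))
    (hs1 : Nontrivial (Abelian.Ext X S.X₁ s))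
    (hx0 : ∀ x : Abelian.Ext X S.X₁ s, x.comp (Abelian.Ext.mk₀ S.f) (add_zero s) = 0) :
    ∃ r, r + 1 = s ∧ (∀ i < r, Subsingleton (Abelian.Ext X S.X₃ i)) ∧
      Nontrivial (Abelian.Ext X S.X₃ r) := by
  obtain ⟨x, hx⟩ := exists_ne (0 : Abelian.Ext X S.X₁ s)
  cases s with
  | zero =>
    have := hS.mono_f
    exact absurd (Abelian.Ext.postcomp_mk₀_injective_of_mono X S.f
      ((hx0 x).trans (hx0 0).symm)) hx
  | succ s =>
    refine ⟨s, rfl, fun i hi ↦ ?_, ?_⟩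
    · refine subsingleton_of_forall_eq 0 fun y ↦ ?_
      have := hs0 (i + 1) (by omega)
      obtain ⟨z, rfl⟩ := Abelian.Ext.covariant_sequence_exact₃ _ hS y rfl
        (Subsingleton.elim _ _)
      have := hF i (by omega)
      rw [Subsingleton.elim z 0, Abelian.Ext.zero_comp]
    · obtain ⟨y, hy⟩ := Abelian.Ext.covariant_sequence_exact₁ _ hS x (hx0 x) rfl
      refine ⟨y, 0, fun hy0 ↦ hx ?_⟩
      rw [← hy, hy0, Abelian.Ext.zero_comp]

variable [IsLocalRing R]

/-- The lowest degree in which Ext from the residue field to `M` does not vanish is `s`. -/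
def IsLeastResidueExt (R : Type) [CommRing R] [IsLocalRing R] (M : Type) [AddCommGroup M]
    [Module R M] (s : ℕ) : Prop :=
  (∀ i < s, Subsingleton
    (Abelian.Ext (ModuleCat.of R (R ⧸ maximalIdeal R)) (ModuleCat.of R M) i)) ∧
  Nontrivial (Abelian.Ext (ModuleCat.of R (R ⧸ maximalIdeal R)) (ModuleCat.of R M) s)

theorem IsLeastResidueExt.moduleDepth_eq {M : Type} [AddCommGroup M] [Module R M] {s : ℕ}
    (h : IsLeastResidueExt R M s) : moduleDepth R M = s := by
  refine le_antisymm (sInf_le ⟨s, rfl, ?_⟩) (le_sInf ?_)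
  · rw [← not_subsingleton_iff_nontrivial, subsingleton_extGroup_iff,
      not_subsingleton_iff_nontrivial]
    exact h.2
  · rintro _ ⟨k, rfl, hk⟩
    rw [← not_subsingleton_iff_nontrivial, subsingleton_extGroup_iff] at hk
    by_contra! hlt
    exact hk (h.1 k (by exact_mod_cast hlt))

theorem free_of_hasProjectiveDimensionLT_one (M : Type) [AddCommGroup M] [Module R M]
    [Module.Finite R M] (h : HasProjectiveDimensionLT (ModuleCat.of R M) 1) :
    Module.Free R M := by
  rw [← projective_iff_hasProjectiveDimensionLT_one, ← IsProjective.iff_projective] at h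
  exact Module.free_of_flat_of_isLocalRing

/-- A minimal first syzygy; its projective dimension is one less. -/
theorem exists_minimal_syzygy {p : ℕ} (M : Type) [AddCommGroup M] [Module R M]
    [Module.Finite R M] (h : HasProjectiveDimensionLT (ModuleCat.of R M) (p + 2))
    (h' : ¬ HasProjectiveDimensionLT (ModuleCat.of R M) (p + 1)) :
    ∃ (n : ℕ) (f : (Fin n → R) →ₗ[R] M), Function.Surjective f ∧
      LinearMap.ker f ≤ maximalIdeal R • (⊤ : Submodule R (Fin n → R)) ∧
      HasProjectiveDimensionLT (ModuleCat.of R (LinearMap.ker f)) (p + 1) ∧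
      ¬ HasProjectiveDimensionLT (ModuleCat.of R (LinearMap.ker f)) p := by
  obtain ⟨n, f, hf, hker⟩ := exists_minimal_cover R M
  have hS := LinearMap.shortExact_shortComplexKer hf
  have hP : Projective (ModuleCat.of R (Fin n → R)) :=
    (IsProjective.iff_projective (Fin n → R)).1 inferInstance
  exact ⟨n, f, hf, hker, (hS.hasProjectiveDimensionLT_X₃_iff p hP).1 h, fun hK ↦
    h' (hS.hasProjectiveDimensionLT_X₃ p hK
      (hasProjectiveDimensionLT_of_ge (ModuleCat.of R (Fin n → R)) 1 _ (by omega)))⟩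

variable [IsNoetherianRing R]

theorem exists_nontrivial_ext_residue_self : ∃ n : ℕ,
    Nontrivial (Abelian.Ext (ModuleCat.of R (R ⧸ maximalIdeal R)) (ModuleCat.of R R) n) := by
  by_contra! h
  obtain ⟨d, hd⟩ : ∃ d : ℕ, ringKrullDim R = d := by
    have h1 := ringKrullDim_ne_bot (R := R)
    have h2 := ringKrullDim_ne_top (R := R)
    generalize ringKrullDim R = x at h1 h2
    induction x with
    | bot => exact absurd rfl h1
    | coe x =>
      induction x with
      | top => exact absurd rfl h2
      | coe d => exact ⟨d, rfl⟩
  obtain ⟨rs, hlen, -, hreg⟩ := ModuleCat.exists_isRegular_of_exists_subsingleton_ext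
    (maximalIdeal R) (d + 1) (ModuleCat.of R R)
    (by
      rw [lt_top_iff_ne_top, smul_eq_mul, Ideal.mul_top]
      exact (maximalIdeal.isMaximal R).ne_top)
    (ModuleCat.of R (R ⧸ maximalIdeal R))
    (by rw [Module.support_eq_zeroLocus, Ideal.annihilator_quotient])
    (fun i _ ↦ h i)
  have h1 := ringKrullDim_add_length_eq_ringKrullDim_of_isRegular rs hreg
  have : Nontrivial (R ⧸ Ideal.ofList rs) := by
    have h2 := hreg.top_ne_smul
    rw [smul_eq_mul, Ideal.mul_top] at h2
    exact Ideal.Quotient.nontrivial_iff.2 h2.symm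
  have h3 := ringKrullDim_nonneg_of_nontrivial (R := R ⧸ Ideal.ofList rs)
  rw [hlen, hd] at h1
  have h4 : ((d + 1 : ℕ) : WithBot ℕ∞) ≤ (d : ℕ) := by
    rw [← h1]
    exact le_add_of_nonneg_left h3
  have h5 : d + 1 ≤ d := by exact_mod_cast h4
  omega

/-- The top Ext group from a module of finite projective dimension to the residue field
does not vanish. -/
theorem nontrivial_ext_to_residue (p : ℕ) (M : Type) [AddCommGroup M] [Module R M]
    [Module.Finite R M] (h : HasProjectiveDimensionLT (ModuleCat.of R M) (p + 1))
    (h' : ¬ HasProjectiveDimensionLT (ModuleCat.of R M) p) :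
    Nontrivial (Abelian.Ext (ModuleCat.of R M) (ModuleCat.of R (R ⧸ maximalIdeal R)) p) := by
  induction p generalizing M with
  | zero =>
    have := nontrivial_of_not_hasProjectiveDimensionLT_zero M h'
    obtain ⟨f, hf⟩ := exists_surjective_linearMap_residue R M
    refine Abelian.Ext.homEquiv₀.nontrivial_congr.2 ⟨ModuleCat.ofHom f, 0, fun hf0 ↦ ?_⟩
    obtain ⟨x, hx⟩ := hf 1
    have : f x = 0 := by rw [← ModuleCat.hom_ofHom f, hf0]; rfl
    exact one_ne_zero (hx.symm.trans this)
  | succ p ih =>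
    obtain ⟨n, f, hf, hker, hK, hK'⟩ := exists_minimal_syzygy M h h'
    have hS := LinearMap.shortExact_shortComplexKer hf
    obtain ⟨x, hx⟩ := @exists_ne _ (ih (LinearMap.ker f) hK hK') 0
    refine ⟨hS.extClass.comp x (add_comm 1 p), 0, fun h0 ↦ hx ?_⟩
    obtain ⟨y, hy⟩ := Abelian.Ext.contravariant_sequence_exact₁ hS _ x (add_comm 1 p) h0
    rw [← hy]
    cases p with
    | zero =>
      obtain ⟨g, rfl⟩ := Abelian.Ext.homEquiv₀.symm.surjective y
      have hg : f.shortComplexKer.f ≫ g = 0 := by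
        ext z
        have hz : (g.hom : (Fin n → R) →ₗ[R] _) z.1 ∈
            maximalIdeal R • (⊤ : Submodule R (R ⧸ maximalIdeal R)) := by
          have := Submodule.mem_map_of_mem (f := g.hom) (hker z.2)
          rw [Submodule.map_smul''] at this
          exact Submodule.smul_mono le_rfl le_top this
        have hbot : maximalIdeal R • (⊤ : Submodule R (R ⧸ maximalIdeal R)) = ⊥ := by
          rw [eq_bot_iff, Submodule.smul_le]
          intro r hr y _
          exact Module.mem_annihilator.1
            ((Ideal.annihilator_quotient (I := maximalIdeal R)).ge hr) y
        rw [hbot] at hz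
        exact hz
      rw [Abelian.Ext.homEquiv₀_symm_apply, Abelian.Ext.mk₀_comp_mk₀, hg, Abelian.Ext.mk₀_zero]
    | succ p =>
      have hP : Projective (ModuleCat.of R (Fin n → R)) :=
        (IsProjective.iff_projective (Fin n → R)).1 inferInstance
      have hy0 : y = 0 := @Abelian.Ext.eq_zero_of_projective _ _ _ _ _ _ _ hP y
      rw [hy0, Abelian.Ext.comp_zero]

theorem nontrivial_ext_of_projectiveDimension (p : ℕ) (M N : Type) [AddCommGroup M] [Module R M]
    [Module.Finite R M] [AddCommGroup N] [Module R N] [Module.Finite R N] [Nontrivial N]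
    (h : HasProjectiveDimensionLT (ModuleCat.of R M) (p + 1))
    (h' : ¬ HasProjectiveDimensionLT (ModuleCat.of R M) p) :
    Nontrivial (Abelian.Ext (ModuleCat.of R M) (ModuleCat.of R N) p) := by
  obtain ⟨f, hf⟩ := exists_surjective_linearMap_residue R N
  have hS := LinearMap.shortExact_shortComplexKer hf
  obtain ⟨x, hx⟩ := @exists_ne _ (nontrivial_ext_to_residue p M h h') 0
  obtain ⟨y, hy⟩ := Abelian.Ext.covariant_sequence_exact₃ _ hS x rfl
    (Abelian.Ext.eq_zero_of_hasProjectiveDimensionLT _ (p + 1) le_rfl)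
  refine ⟨y, 0, fun hy0 ↦ hx ?_⟩
  rw [← hy, hy0, Abelian.Ext.zero_comp]

theorem exists_isLeastResidueExt_self : ∃ t, IsLeastResidueExt R R t := by
  classical
  have h := exists_nontrivial_ext_residue_self (R := R)
  exact ⟨Nat.find h, fun i hi ↦ not_nontrivial_iff_subsingleton.1 (Nat.find_min h hi),
    Nat.find_spec h⟩

/-- The Auslander–Buchsbaum formula. -/
theorem exists_isLeastResidueExt_add_eq {t : ℕ} (ht : IsLeastResidueExt R R t) (p : ℕ) (M : Type)
    [AddCommGroup M] [Module R M] [Module.Finite R M]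
    (h : HasProjectiveDimensionLT (ModuleCat.of R M) (p + 1))
    (h' : ¬ HasProjectiveDimensionLT (ModuleCat.of R M) p) :
    ∃ s, s + p = t ∧ IsLeastResidueExt R M s := by
  induction p generalizing M with
  | zero =>
    have := nontrivial_of_not_hasProjectiveDimensionLT_zero M h'
    have := free_of_hasProjectiveDimensionLT_one M h
    exact ⟨t, rfl, fun i hi ↦ subsingleton_ext_of_free (ht.1 i hi) M,
      nontrivial_ext_of_free ht.2 M⟩
  | succ p ih =>
    obtain ⟨n, f, hf, hker, hK, hK'⟩ := exists_minimal_syzygy M h h'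
    have hS := LinearMap.shortExact_shortComplexKer hf
    obtain ⟨s, hst, hs0, hs1⟩ := ih (LinearMap.ker f) hK hK'
    have hF (i : ℕ) (hi : i < t) := subsingleton_ext_of_free (ht.1 i hi) (Fin n → R)
    obtain ⟨r, hr, hr0, hr1⟩ := exists_least_ext_of_shortExact hS (by omega) hF hs0 hs1 fun x ↦ by
      cases p with
      | zero =>
        have := free_of_hasProjectiveDimensionLT_one (LinearMap.ker f) hK
        exact ext_comp_shortComplexKer_f_eq_zero
          (Ideal.annihilator_quotient (I := maximalIdeal R)).ge f hker x
      | succ p =>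
        exact @Subsingleton.elim _ (hF s (by omega)) _ _
    exact ⟨r, by omega, hr0, hr1⟩

end ModuleExt

/-- If `pd M < ∞` and `N ≠ 0`, then `sup {i : Ext^i(M,N) ≠ 0} = pd M = depth R − depth M`. -/
theorem ext_sup_eq_pd_eq_depth_sub_depth (R : Type) [CommRing R] [IsNoetherianRing R]
    [IsLocalRing R] (M N : Type) [AddCommGroup M] [Module R M] [Module.Finite R M]
    [AddCommGroup N] [Module R N] [Module.Finite R N] [Nontrivial N]
    (hpd : ∃ k : ℕ, hasPdLE R k M) :
    sSup {n : ℕ∞ | ∃ i : ℕ, n = i ∧ Nontrivial (extGroup R i M N)} =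
        sInf {n : ℕ∞ | ∃ k : ℕ, n = k ∧ hasPdLE R k M} ∧
      sInf {n : ℕ∞ | ∃ k : ℕ, n = k ∧ hasPdLE R k M} =
        moduleDepth R R - moduleDepth R M := by

  have hpd' : ∃ k, HasProjectiveDimensionLT (ModuleCat.of R M) k := by
    obtain ⟨k, hk⟩ := hpd
    exact ⟨k + 1, (hasProjectiveDimensionLT_iff_hasPdLE k M).2 hk⟩
  have hnon (i : ℕ) : Nontrivial (extGroup R i M N) ↔
      Nontrivial (Abelian.Ext (ModuleCat.of R M) (ModuleCat.of R N) i) := by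
    rw [← not_subsingleton_iff_nontrivial, subsingleton_extGroup_iff,
      not_subsingleton_iff_nontrivial]
  obtain ⟨t, ht⟩ := exists_isLeastResidueExt_self (R := R)
  classical
  have hspec := Nat.find_spec hpd'
  have hmin : ∀ m < Nat.find hpd', ¬ HasProjectiveDimensionLT (ModuleCat.of R M) m :=
    fun m hm ↦ Nat.find_min hpd' hm
  generalize Nat.find hpd' = q at hspec hmin
  cases q with
  | zero =>
    have hle : sInf {n : ℕ∞ | ∃ k : ℕ, n = k ∧ hasPdLE R k M} = 0 :=
      nonpos_iff_eq_zero.1 (sInf_le ⟨0, rfl, (hasProjectiveDimensionLT_iff_hasPdLE 0 M).1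
        (hasProjectiveDimensionLT_of_ge _ 0 1 (by omega))⟩)
    have hzero := isZero_of_hasProjectiveDimensionLT_zero (ModuleCat.of R M)
    have hM : moduleDepth R M = ⊤ := by
      refine sInf_eq_top.2 ?_
      rintro _ ⟨k, rfl, hk⟩
      rw [← not_subsingleton_iff_nontrivial, subsingleton_extGroup_iff] at hk
      refine absurd (subsingleton_of_forall_eq 0 fun x ↦ ?_) hk
      rw [← x.comp_mk₀_id, hzero.eq_of_src (𝟙 _) 0, Abelian.Ext.mk₀_zero, Abelian.Ext.comp_zero]
    rw [hle, hM]
    refine ⟨nonpos_iff_eq_zero.1 (sSup_le ?_), by simp⟩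
    rintro _ ⟨i, rfl, hi⟩
    rw [hnon, ← not_subsingleton_iff_nontrivial] at hi
    exact absurd (HasProjectiveDimensionLT.subsingleton (ModuleCat.of R M) 0 i (by omega) _) hi
  | succ p =>
    have hp := hmin p (by omega)
    have hpdeq : sInf {n : ℕ∞ | ∃ k : ℕ, n = k ∧ hasPdLE R k M} = p := by
      refine le_antisymm
        (sInf_le ⟨p, rfl, (hasProjectiveDimensionLT_iff_hasPdLE p M).1 hspec⟩) (le_sInf ?_)
      rintro _ ⟨k, rfl, hk⟩
      by_contra! hlt
      have hlt' : k < p := by exact_mod_cast hlt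
      exact hmin (k + 1) (by omega) ((hasProjectiveDimensionLT_iff_hasPdLE k M).2 hk)
    obtain ⟨s, hs, hsM⟩ := exists_isLeastResidueExt_add_eq ht p M hspec hp
    rw [hpdeq, ht.moduleDepth_eq, hsM.moduleDepth_eq]
    refine ⟨le_antisymm (sSup_le ?_) (le_sSup ⟨p, rfl, (hnon p).2
      (nontrivial_ext_of_projectiveDimension p M N hspec hp)⟩), ?_⟩
    · rintro _ ⟨i, rfl, hi⟩
      by_contra! hlt
      rw [hnon, ← not_subsingleton_iff_nontrivial] at hi
      have hlt' : p < i := by exact_mod_cast hlt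
      exact hi (HasProjectiveDimensionLT.subsingleton (ModuleCat.of R M) (p + 1) i (by omega) _)
    · have hps : p = t - s := by omega
      rw [hps]
      exact ENat.natCast_sub t s
end
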